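/- arXiv:1906.11908 — 2 statements merged into one kernel-verified Lean document; each statement's English description precedes it below -/
import Mathlib

section
/- There exist 59 distinct points in ℝ² and a set E of 118 unordered pairs of these points such that every point is an endpoint of exactly 4 pairs in E, the closed segments of any two distinct pairs intersect at most in a common endpoint, exactly 115 of the pairs join points at distance exactly 1, and each of the remaining 3 pairs joins points at a distance d with |d − 1| < 0.03. -/
open scoped Classical

def CX : ℕ :=
  879254722678847021309403819262015147813305085422759269307615780558689666782347757726779971600462748631533745719978892931714915309764659986185399703249054136699276600084686972867989687399585380678912297622641033019832634482338202609663232460599757622375593387046313582789439580596865881471546689171478549121675117541514042123516077410784499801224636500238644666500743023429483153189009459347511918449144525161446712021522404737242302418456379169406083224703400761841133389435189076361351358436359870708384322450598042314383340696312365224769301285037599295717189142340962683779284281394129281307712801251759999563221652741824219238604997218647224836241630066622186125830270181975095644153604435704121083041137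

def CY : ℕ :=
  548874574181454211978249628880043013360067322317708885511845265580955232530483412702536922099833436338756771616927568665342194100839696933037498329009815023788890980678230343276802499101179384598740358157707603310275401612423651293772136593798687565582195105598372626315639873541570561963353733828471453704238724717399895180258534458162159867919942808484150487569145843679258472397070717226738390451566602950351596192698541165672304625969326294194752536730798268204188293357013858403688007770707010792092597989154919498315089290229637153518788052257890328241630646696260731082339968147430616003118125434532193956535745505167529096240483264521770306707794644932359085816832627537031975453649863359548213909886

def RX : List ℕ := [
  498497497499498499501502500501502497504498498502495494501503515498500497502518500482498500500500505499497500478481499520500497516515500501489499499516497516503488465507485513504494478489460491519512501496492499509505508483500506501482516468522496495490505513594505508505408495488504498467495490596406488498503494507507497504485492509501459481492,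
  498498497498497498501500501500502499502500499502497498502500507496499497500508503491498501501501501499494499493490495505499498504505500501498500500505492505500497486497501503499497499501481501503503492497497499502503498495500500501497503482513488497495499504537504510506459495514505497478537483536477494498503477524488497504491475465464514487486,
  497496497496498499502501500501502498503499498502496496501499512498500497503515500488497500500500500499498501481487499517500496514514500501489499499515498515497488473506485514502495478488469490515513503496484499508504507484500501501483516477519499496482500512588505505516414510487470525508492494589409478485516497504510483466462495506507499502501,
  499499496498496498500498501500502501500502499502499502504498500494498497497498506501498501501502498499491498508500492490499499493494500500506502501493488493497506506487517494495500519514501510488494482499501500495501488507500495501511490495503479498500494495479502512507510494540505497490520476476549499498503461480468496504496519482475508493493,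
  496494496493499499504500500501502499501500498502498498500493508499500498503510499497497499500500493498499501486496500512500495510511500502490499499512500512490488484504486516500496481490482491509514504497476498507503504487500496502486515488510502497473495510573504498530427532489486513503493498574423467468482498503512517484491496506510495506505,
  499500496497495498499496501499502503498503499502501506505495493492497497494488508511498502502503494500488497523510489475498500482484500500515503502482484482493515526477533485491502540527522519473485473501506500488500478519500490500525476509493471500506489487422500514508561493506505496501502469416560504498503504497497496505502502499499502498499,
  498498497499498499501502500501502497503499498502496495501502513497499497502516501484498500500500505499496500481483498517500497514513500501491499499514496514502490469505488511503495482491464493516510499496493499507504506485500505501485514471520495495491503511583505508505419495493504498469504489584420489498503491510503497504487489512493518482481,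
  498498497500498499501503500501502496504498498502495493501504516498500497502520500478498500500500508499497501476477499523500497518517500501488499499518497518506487460508483513505494475487455490522512502495494499510505510481500508501480518464529497494492507514605506513501399485485453481513490490607394491505496496505509503497495494507504504497497,
  498499497498497498501500501500502500501500499502498499503500506495499497499506504493498501501501501499493499496492495502499498502503500501499500500503491502499499490495504501499498503504485502500501490498497499500503496497500499501499500485511486497496498502525503510506469494519505497481534482524492495498503474527484497504492532469457512488488,
  497496497497498499502501500501502498503499498502496495501499513498500497503515500487497500500500501499498501481486499518500496514514500501489499499515498515498488471506484514502495478488467490516513503496486499508504507483500502501483517475520499495483501512590505506514412507487468527508492494591408480488513497504510537464466495507507500502501,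
  499500496498496498500497501500502502499502499502500503504497499494498497496496506503498501501502497499490498512502492487499499491492500500508502501491487491496508510485520492494500523517505511485492480499502500494501486509500494501513487498501478499501493494468502512507520494533505497492516475464563500498503517484464496504498515485480507494494,
  496494496494499499504500500501502499502500498502498497500494509499500498503511499496497499500500494498499501486494500513500496510512500502490499499513500513491488483505486515500496481489480491510514504497478498507503504486500497502485515487511501496474495510575504499528425536488484515503493497576421469521480497503512520481488495506509496506505,
  502503500498499498496495501500502504497503499502503507501496491497497497491485511514498498501503493499493497529513485469500496477483500500519503502482489482492519533470530481485504553535527523466481479515507500470485469527500486501531470511492492515507485454388485517511588491509506496503503506416588503497504506495488495506500504497493505495496,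
  494492495490499499505499499502502501500501497502499500500488505499500498503505499506497499501500486498500501491504500508501495506508500502491500499509501510482489496502488517497498484491495491503515505498468498505502501490500490502488513500501504498464489507558503491493440502490501501498494502559436514501500498502513500501513496505512491511509,
  497499494496492498501496502499502503498504500502501506507495495490497497496490507509498504502503494500485497520508491479498503484485500500513503502482481483494513522481535487494502533523519516477487469492505500498508483515500491500521480507494459492505490504441486512506546494504505496501501512450545504499502503498501497504503501500502500500501,
  498498497501498499501503500501502496505497498502494492502506519497500497503523500474498501500500511499496500472473499526499498521519500501487499499520495519509486454511482514507493474487448491526513501495496499510506512479500511501480520458513495494494510515612506495495394501484502500516490488614389495502499495506507500501496493508502506495494,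
  516516516513517499484498500501502502499497498502500497484512505519499497483507517485497483499501513499517499509484477488505478494507500501512499500510516509510511492470478486477501471480477471482485521497519499510504488487500498501462479495504517496517497513591505489491393503485501501494492512593389516503498495506530501500518493509525485517517,
  503502503499506499497498500502502501500499498502499498494498505507499498495506506497497493500500497498506500498495491500502488502508500502499499499510507510494497493490484505490499479486487483495529511498489524507503496488474473476478524497503509497511504510572504484487420505488500502497493505574416511503497497504520502499513495506517489513512,
  502502500499500498497496501500502503498502499502501504500497496499498497493493509506498498501502496499495498517505488481500495487491500501512502501491493491495511517478517489488502536525511516478488487514503499476486477517500491501520481500499499513502490461219487516510802492536506496494518511209805499497504520482456495506496517483474510491491,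
  501502498498497498498495501500502504497503499502502507503496492495497497493487510512498500502503493500490497526511487473499498480483500500517503502482486482493517529474532483488503546531524521470483475507507500480493474522500488500527474510492481529506487512407471515509573492507506496502503508428573504498503505496493496505501503498496504497498,
  493491494489498500506499499502502501500501497502499500501487504499500498504505498507497500501499485498499501490505501508501496507508500502489500499509501510481487496504488518498497485491496492504513505499466495505502502490503492499489512500501503498516494507556503492494442502491501501498494501557438514501500499502513500501513497505512492510509,
  496497492495490498502497502499502502499504500502500506509495496487497497498491505508498506502503495500482497517507493482497505486485500500511503502483478483495512519484537488497501526518516514481489466484505500508494488511500493500518483506495510506505492500459494509505531494502505497500500514462530504500501502499505498504504500501505499502503,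
  512511511509513499488498500501502501500497498502499497488508505514499497487507513488497487499501508499513500505487482493504482497508500501507499500510513510505506491478480492482500473482479476488491517497510499509503491487500513501468534494505514496507512512586504477482401508486498503496492509588397509505495495506526504497513493508522487515515,
  506506505506506499494501500501502498503497498502497494494509513506499497495516507479498493499500512499505500488478490510502489509514500501498499500515504515509497470493480502494496472484461483507501510496506499510505502482500505501500502510493504495504504514603506492493394502484501500507491498605389504502499495506517500501505493508512497504504,
  495496493497492498503500501500502499502501499502497499507499507490498497502507501492498505501501501499487499493491498505498503504502500500497501501501485501500497487500511503504497541498483500505503482524497500465477503577500501501496504485510504523496500441059477507503963496557504497482529525046970496499501529472440498503495527474467508492493,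
  508509507501507498491493501500502506494503499502505508494496487507497497485481516518498491501503491499503498540517479459502487470481500501525502502481499481490524545459522476474506532519536531453475491505509499486495516521500481501542460515489495505508480480367496524517653489517508495505507499360654503495506511490471493508497509492481511489489,
  502501502498505499498499500502502501500499498502499499495497505506499498496506505498497494500500496498506500497497492501502489502508500502498499499510506510492496494492484506491499479487488484496527511498486527507503497489529475473479522497503508497512503509570504485488423505488500502497493505572419512503498497504519502499513495506516489513512,
  499500496497494498500496501499502503498503499502501506505495493492497497495488508510498502502503494500487497523510489476498501482484500500515503502482483482494515526478534485491502539526521518474485472521506500530479479518500490500524477509493491521506489508425480513508558493505505496501502510440558504498502504497497497505502502499499502499500,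
  501501501502502499498501500501502498503498498502496494498504513502499497499517503482497497500500507499501500483481495515501493512515500501493499499516501515504492469501482508499495475486503487533507506496496499509505505483500521501485517509494501495494520513598505481485402506485499502508491495600397497505496496505513503498500494507508499502502,
  492490493487497500507499499502502501500501497502499500502486504498500498505505497508497500501499483498498501489506502509500496507508500502488500499509500510479486496506489513499497485492497493505511504499521498505502502490500495502491511500501503498517493507555503493494444502491501500498494501555440514501500499502512499501513497504511492510508,
  494496490494488498504497502499502501500504500502500505511495497484497497500492504506499508502503495500479497514505495485496508489486500500509503502483475483496510515488517490500500519514512511485491525498504500495502493507500495500515486505496521498505494496478502507503516495500504497499499516474515504500501501500510498503505499502508497503505,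
  499500496497494498500496501499502503498503499502501506505495493492518497495488508510498522484482494500508518523510489476492522482472500500515464481467525467494515526478519485510501524516521518474485514500506500492500501511500490500524477508493512500506489491444500513508559493505505496501502510440558504498502504497497497505502502499499502499500,
  489488490488493499510501500501502498503501498502497497506489511492500498509512494498497505501499489527493501477526507522499501516513471473472500498514494514514493504516488504508495484492510497509503499497508498506503510486500505502498504510494496497505504509572504492493433502489501501507493492573429504502499498503506500501503496505504500502500,
  508509507501507498491493501500502506494503499502505508494496487507497497485481516518498491501503492499503498539517479459502487471480500501525503502480499481490524544459523476529507534520536530453475491506509499485495516522500481501541460515489495505508480479361495524517660489518508495505508499354661502495506511490470493508497509492480512489489,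
  495496493497492498503500501500502499502501499502497499507499507490498497502507501492498505501501501499487499493491498506498503505502500500497501501500485500500497486500512503504552542498483499505503481524497500465477503578500502501495504484511503523496501440053477507503969496558504498481529525039977496499501529472439498503495527474467508492492,
  499498498497499499500499500501502500501500498502499499500497505498500497499505504497498500500500497499498500498496494501500496517517500501499499499518498517495498494543483504504494475487509490532503503495491499510505509481500524501489513513491497495489523514603506481485400506485499502512490491606395493505496496505510503498496494507505503498498,
  487485486488488499512503500501502496505500498502494494510492517487500498514520491488497509501499494499487501465487511534497507525519500501508499498518489519491507511526488495516492482493524501513494494496495499508504517481500516501505498520487489495492514512589505490492422503487501501516491484590418493502499498503499501500494496506497508493492,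
  496497492495490498502497502499502502499504500502500506509495496487505497498491505508498513495495495500490505517507493482495513486481500500511489517477533463495512519484518488504501520515516514481489521499505500494501496508500493500518483506495518498505492494466502509505531494502505497500500514462530504499501502499505498504504500501505499502503,
  492490493487496500508499499502502500500501497502499500502486505497500498506505497507497501501499484501498501488508503511500497508509497505487500499510499510534482497507489512500497485492498493505511503498520498505502503490500496502491510501500502498516494507556503493494443502491501500499494500557439513501500499502511499501512497505510493509508,
  501502498498497498498495501500502504497503499502502507503496492495525497493487510512498527477474493500519504526511487473491528480467500500517512496461521469493517529474520483514502525517524521470483510501507500491499504512500488500527474510492509500506487489432500515509574492507506496502503508427573504498503505496493496505501503498496504497498,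
  501502499499499498498497501500502502499502499502501503501498497498498497494495508504498498501502496499495498515503489483533526488476500501510502501491492491495510514480517490516530538509508514480490486515503499474485510551500492501517483499500499514502491459200486515510821492539506496492519512190825499497504521480454495505496519482473510491491,
  489487490488492499510501500501502498503501498502496497506489511492500498510513493497497505501499489524492501476528507523499502517514526476471499498514494515512495505517488503509494483492512497509502498497507498506503511485500506502499504511493495496503505510574504491493432502489501501508493491575428503502499498503505500501502496505503501501499,
  484483484483485499514501500501502498503502498502497499512485509484501498513508491503497512501499485499484501520502511540496510530521500501514499498520485520482513516528488490521490481494530504513489490496490499508505521480500519501510493524483485495487518512594506491492420502487501501520491480596415489502499498503496500500490496506493512489488,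
  510510508507509498490497500501502502499499498502500499491506502509499497488502486492498491499501506499508500481491546519503487507514500501487499500516507515505487477555478514491497470481494479547513512495493499511505500482500528501474528505497506494491527515610506474479384509483497503507490500613380495507494494507520505496501492509513496505505,
  497499494496492498501496502499502503498504500502501506507495494490512497496490507509498518489510494500540490520508491479494518484476500500513497510471528465494513522480519487507501522515519516477487517500505500493501499509500491500521480507494515499505490492454501512506546494504505496501501512449546504499502503498501497504503501500502500500501,
  492490493487496499508499499502502500501501497502499500502487506496500498506506496512497501501499536498497501487511503512500497509509500502485500499510499511532483498508489511501497485492500493506510503498518498505502504489500497502492509502499501498514496507558503493494442502491501500500494499559438512501500499502510499501511497505510494508507,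
  502503500498499498496495501500502504497503499502503507501496491497511497491485511514498532533489493499506511529513485469490533477462500500519521489455516471492519533470521481517502527518527523466481506502507500490498507513500486501531470511492506501507485487420499517511589491509506496503503506415589503497504506495488495506500504497493505495496,
  497496497513500499502519500501502481520486498502479465499532470500500498518498486506497498500500526498500501485504516515501494509511500502486499499512501512523485492522486512498497480489498489519510506497510498507503503487500507502487515504498503497507505510575504487490424504488500501502493499576420507503498497504513501500508495506511495507506,
  505506514502525510494495489512488504497502488476502505478500494525496510490490502506542475499504498499520496513506499486502516489481500500508502503481515481497508514491511492508506516508513510488492508502504500492498502513500496501514487506496509502503496489429499507503576496507504497500503508425575502500501505496493498503501503498497502499499,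
  502501502536503499498535500501502464486473498502513494496521483504499497529491478500497495500500518499503500484499528517501491509512500501487499499514503513515486486535483512496497476486497485530511508496503499509504502485500515501482520505497504496500514512589505482486408506486499502504492499591404502504497496505516503498505494507511496506505,
  514515544509517530486494469473465505496500527481503504485506493517497532481491491502523483499502504499514498501501514500502505497495500501500500502495511495503499501514498501502502498498506499509500509500501499500501502500500507501499502506496507499500506500501501495494500501498502500503498504499498501502499501500504500501502499502504500501502,
  507507506507507499493501500501502498503518498502496515493510497507499497539484469495498493499500509499506500483494539519502489508514500501488499500515505515507487481548480513493497472483496482541512510496495499510505501483500524501478524506497505495493523514603506477482392508484498503506491499606388497506495495506518504497502493508512497505505,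
  523524515517509491477493508493489506495498506496504503492512492509499555473491480498504491499501510499507500488497530513502494505508500501491499500510506509508490487536486509496498480488499487530509509497499499507504501488500517501484517505497505496497516510573504483486425506488499502505493500574421499504496497504514503498503495506510497504504,
  499500496497495498499496501499502503498503499502501506527495493533497497494488508511498523505503494500528498524510489475492524482471500500515506502466524467493515526477519485511502524516522519473485513501506500492500501511500490500525476509493511500506489490442500514508562493506505496501502509437561504498503504497496496505502502499499502498499,
  496495497510499499503516500501502483517488498502532470500534468500500498517499488507497499500500527498500501486505515514501495509511500502486499499512501512524484492521486512499497481489498490517510505497511498507503503487500505502488514503498502497508504510573504488490426504489500501502493499574422507503498498503513501500508496506511495507506,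
  506507520503523514493495485516484504497502543468502505479501494524496514488490500506538477499504499499519497511505502489502514490484500500507501503484514483498506512496509493507505513506512508492493508502503500494499502510500498501511490506496508501502498491443499504501561497506503498501502508439561502500501505496495498503501503498498502499500,
  501500501540503499498533500501502517483475498502516491497523481503499497527492479501497496500500519499502500484500526516501492509512500501487499499513503513516486487533483512496497477486497486528511508497504499508504502485500514501483519505497504496501513512587505483486410506487499502504492499589406503504497496505515502498505494507511496506505,
  516517539511515534484494524477460505496500523484503504486507493516498536480491489502519485499502505499512498498501517502502503499497500501498500501498510497504497498518496502501501495496505496513502509499501499501501502498500509501496505506496507498499508502515502492493486502496501500503497504513483500502498500501505501500502498503505499502502,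
  506513505512506499544499500501502500500513498502499512494512495506499497538485470496498493499500510499505500483495538519502489509513500501488499500515505514508487482546480512494497473484496482539512510496497499510505501483500523501478524506497505495494521514601506478482395508484498503506491499604390498506495495506518504497502493508512496505505]

def RY : List ℕ := [
  501500503496504501499497499501500503498502500499502504497493496505502500497493502510501499499499490499507500511508497489500500491492501501506499501490508489488506515492507495496504516510513508489492507506491498491494492512501498501513488506497515504488500487430497510511564498507501500505502520425562484494505507493510496503476506494520509470529,
  501500502496503501499496499500500504497502500499502505497493493504501500496489503514501499499499489499506500516512496484500500487488501501509500501487507485487509522488512492494505523514520511484489504507492498489494488516501497500517483511494512505490498484410497510511582497516501500509517518405587486494505501499504496503478501479507528472469,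
  502501503498503500498498499500500502498501500499501503497496498504501500496495503505501499499499494499507500509504496491500501493493501501506499501491507490492506509492507494497503516510507508492491505506496498491495493511501502500512488500500512504494503488435498512502560486508527479473505517431560492504495505495508506531494505496515478524522,
  501501502496503500499495500500500504496503500499503507498492491504501500495486504517501499499500488499505499521515495478500500483484501501512500502483505481486512529485518489493506530518528514479486500508494498486493485521501495500522478516491509505491496481390496511512599497525501500513511515384611488494505496484497496503480516485453526474471,
  503502503501503500497499500500500501499500500500500501497500500504501500496499503499501499499499500499506500505497496494500501495495501500505499501493506492498506501494506493499502513509497508496490505505502498492496495509501506500510489491506511503500507490446498517492550470507516488477504514442550500517520505496507481519541504497513481520519,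
  502501502495502500499495500500500505495503500499504508498491488503501500494483505520501499500500486499504499526518494473500501479481501500515500502479504477484515536481523486491506537523535517473483497508495498484493481525501493500527474520487506506493494478371495512512617497513502500517505513363615489494505511490449496503482510491461524476473,
  502501502495502500499495500500500505495503500499504508498491488503501500494483505520501499500500486499504499526519494473500501479481501500515500502479504477484515536481523486491506537523535517473483497508495498484493481525501493500527474520487506506493494478370495512512617497534502500517546513363636489494505490510490496503482489511482524476473,
  502502503500503500498498500500500501499501500499500502497499500504501500496498503501501499499499498499506500506499496493500501495494501500505499501493506491496506503493506493498502514509500508495491505505500498492496494510501504500511488494504511503498506489442498515495554476507519460476505515438553497513486505495507514485509504497514480521520,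
  502501502495502500498494500500500506495504501500505509499490486503500500493479506524501499500500485499503499532522492468500501475477501500518501502475502474483519543478529483490507545527542520468480494509497498481492478529501491500532469525484503507495492475351495512512634496543502500521499510342661491494505484516484496503484504497469522478475,
  503503504502503500497499500500500500500500501500499500498503502504501500496501504495501500499499503499505500503493496497500501497496501500505499501495505493502506495494505493500502512508491508499490504505506499493496496508501509500509489486511509503504510491453499521485544460506508494480504513449543506526474504496506489510530503497512483518517,
  502502502495502500498493500500500506494505501500505511499489483502500500492476507527501500500501484499502498537525491463500502471473501500521501503471501470482522550474534479488508552532549523463477490509499499479492474533501489500537465530480500507497490472331494513513652496489502499525492508322686493494505499501477496503486498502478520480477,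
  504505504505503500496500500500500499501499501500498499498506505503501500496505504488501500498499508499505500499487496500499502500498501500504498501497504495507505487496504492502501510507481508504489503504512499494497498505501513500507491477517508502511514492464499526475534507504497503483503510461534514501498503497505502497514503498510486515514,
  498498498494497500502496500500500504497504501500502507503491491497501500498486502517501504500500487499498499519515498481498506484482501500510501502479497478486511528489528490498505522513528512482487489490494499505511492516501497500520481517489480488492498518412513507508584498509501500515503469450582490496504508492459497502484507493468520480477,
  504504504503503500496499500500500500500500501500499500498504503504501500496503504492501500498499505499505500501491496498500502498497501500505499501496505493504505492495504492501501511508487508501490504504508499493497497507501510500508490483513509502507511491457499522519541492505504497481503512453540534492507504496506494506525503497511484517516,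
  497497497493496500503496500500500503497504501500502507504491492496501500499487501516501505500500487499497499518514499482498508485482501500509501502480496478486510526491529491500504518511526510484488488486494499510515495514501498500518483517490475484492499526421458506508577499508500501515503470456575490496503508493461497501485507494470519481478,
  502502502502501500498500500500500500501500501500498499499504505501502500498504502491501502499499505499503500497489498502499504501498501500502499501497503495504503488499505495504500511509484510505493502504506499494497499506501512500510494479463507502505513492460499471481540513505493506483503509456540507504495504496503506494510503497509487515513,
  500501500501500500499501500500500499502500501500498499501503506500502500500506501490501503499499505499501500494489500505498505503499501500500498501497501495504501485502505497506500512509482512509495500504504499494497501505501513500511497476519505502503514492461499472482540513505493506485503507458540505504495504496501506494509503497507488513511,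
  510511509510508500490499500500500500500498501500499499493511504509501500490504509486501495498500513499510499506484489493501497495497501500511498502496509493512512491486502483495502507505482503495500508504523517495497493506483497481501497481514512502541454493467499517515527494504503498480503514464526532494506503498510495504525502498514483519518,
  498498498493497500502494500499500505496505501500504510504489486496500500496479504524501504500501485499496498530522496470498507476475501500516501503472494470484518542482539483495507536522542518472481483491497499501510485524501493500529472527482474489496494512632512508509398498485501500523491464629393493496504497504487497502488496505485516484482,
  493493492491491500506498500499499502499504501500501506509491495490501500503490498513501510500500489499491499510511503490496513490484501500505501502480489479488506517499533495507503503501520505493493480468492499531533506504501501500510490514492449526491503516462475502504544501504499501513501475482542490497502505495471499500487504496477515485483,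
  514515513515512500486499500499500500500497501500499498490516504513501500486504512482501492498500518499513499510480485489502494493496501500515498502496512493518516489480500477491503505502478499492507511503534531496498491505470489531496502480515515501538458494474500514513517496502502499480502516471517531495505502498514496503525501499517481520519,
  492492491491490500507498501499499502499504501500500506510491496489501500504490497512501511500500489499489499509510504491496514492484501500504501502480488479488505516501534496509502499499518504495494478464492499536477508502501502500509492513492454522491504514471479501503537501503499501512500476488535490498502505496473499500487504496478515486483,
  516517515517514500484499500499500500500497501500499498489518504514501500485505514480502491497500521499515499511478483487502492492496501500517498502496513493520518489477499474490503503501476497490472512503538499496498490505501459500494505479516516501537460495477500512511513496502502499479502517475512530495504502499515497503525501500518481520520,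
  486485485491483500513505501499499494506500501500493495516498517481503500516519487481501518500498503499484501464480518537494522525509501500479498500506484504502480453536509520531493514515457528545518484502485499494499521499501523500468532497503486500484525494478501477486541511504494505503501487475539488503496505496482505494491504497488506494493,
  487487486489484500512501501499499498502503501500497502515492504482501500511501491502502516500500493499483500490500512510494521505493501500493500502488482487492494492518530507521498543478496491517505475507487499483494528516501511500490510501501482505486512478369496493498662504520498502503509486361663487500500512488460501498486511489473513487485,
  487487486489484500512501501499499498502503501500497502515492504482501500511502491501502517500499493499483500489499513511494521506493501500492500501489482487493494490519529507521498544533495491518506474507487499482494528517501511500489511500501482505486513477361496493497670504520498503502510487353671487500500512488459501498486512489473513487485,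
  520522519522517499480499500499500501500496501500499497485523504518500500481505518475502488497500526499518499514474478484503489490496501500521498502496516493526522488471497468486503501499472494486517515503548486497498487504488476513488510478517518501535465496484500509509503498501501499479501519482503529496503501500518498502525500500520480522521,
  488489487489485500510499501499499500500504501500499505514491499483501500508494494509502515501500490500483499502507509499494520497486501499500501502481481480490501507509538500516501484489511499504498471506490499508495519493501506500501499510494477504490508504512497496499504503499498502511499480515501491499500502498483500499489502499486511489488,
  501502500507497499498504501499499496505498502500494494503513515496502500501518500471502506498499519500497500480469501519497509514506501499496498501504496502519497457510502498514496506507510514458496496502519499497499509498501469500519481500500497500519471497494501518515514494501503498498500497492512513494505502498496495504507501499499499502501,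
  525527523526521499476499501499500501500495502500499496482527504522500500477506521471502485497501532500521498518469474480504486488496501499525498503497519493532527486464495525482504498497468490482524518503533499498498485504501467500483515476518521501533469497492500505506494499500500500478501521489493528497502500500522499501525499501522479523522,
  488488486489484500511499501499499500501504502500499505515491499482501500509494493508502516501500490500482499500506510500494521498486501499499501502481480480490500505511480501517500480487510497506499480502490499502499521491501507500500501509494482500490508502521501495499497503498498502510498482521494491500500502499485501498490501499487510490489,
  487487485488483500512500501499499500501504502500498504516491500480497500510495493507502514504504490500477495499506511502495518499488501499498507506484471538491500504512479502516500479487508496508500482502490499503499520491501508500498502509495483500490509503527501494498490504498498502510498483527487491500500501499487501498490500500489509491490,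
  523526522527519499477500501499500500501495502500498495484529507520500500478509520466502487497501534513519498512478476486503488492498488486518497503499516495548470490469494521486503497497474492484520516502527500498499488502501472499487512480515518500527474498499501504505489499499500500482500517497488523498502500501519499501520499501519482519519,
  488488486488483499511498501498499501500505502500500507516489496480504500508490495512502520498497488500483502507511508493493525492534501499503495499531484528489505515506481496517485473492519502499495492495492500511506519471501505499506495516490486493493506518645508496499365503482498502516489478648360493500500493507505501498492493508499507493492,
  488489486488483499511498501498499501500505502500500507516489495481504500507489495513502520498497488500484502508512508492493525492478501499503495499531484528488505516505482496518484473492521502498494492494493500512507519469501504499507493516489486492493506519653509496499357503481498502516489478655353493499500493507506501499492492508499507493492,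
  493494490491487499506495501498499504497506502500503511513489486485502500500477501524502515499499485500486500530522500471494520530514501499517497501511485508486519542460503481531492505510534524456480485500502500498501523493501481499534466516489485498502483499513503519516507493500503498512499482511505498494505502498483495504493501499486512488487,
  522525520527517499478501501499500499502495502500497494486530510517500500480513518462502488497501537500516498507461478491502490496501501499474497503501514497538476493474494517490502496497480494486516514501521500499500491500501477499490509485511515499521478499507502504505484499498500500487500514505483518498501499501516499501516499502516486515515,
  483484481486477499515501501498499498503505502500497504521490503474481500514498489504502503518520491500454479492502515509498507504499501499493538463497481533492496495520478506508499476485502491517504490500488500505501514488501512499491510506497490498489513507553503489494456505493497503508496487554454491501498499502497502497492498502496505495494,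
  522524519527516499478501501499500498503495502500497493487531511516501500481514518460502489497501538531515498504490478494502491497502470531508497503502513498533478495476494515491501496497482494487514513501519500499500493499501479499491508487510513499519480500510502504505482500498500500488499512509480516498501499501515499500514499502514487513513,
  482483480486476499516501502498499498503505502500497503522490503473478500515499489503502501521523491500449535490502516511498504505501501499493534466499483532492495493522477506506499475484500490519505492500488500506501512487501512499489511505497491498489514507559503489493449506493497503508496488559447491502498498502499503497493497503497504495495,
  477477474484470499521505502498499494506504502500493499528492514466505500523512482490502532498496496500470503468489525533543483521527501499479494498548472545497482465541472520495524481473474475544518484510482500494491508518501522499467532490508493508483524485382493481488629509516495504496508501379630487503496509492478505495491508492487504496495,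
  520523518527514499480502501498500497504494502500496492489532514514501499483518516456502491497501541481513498499499480499501493502504483517500497503504510500523484498480494511495500495498488496488510510501513500500500496497501483499494505491507510499513485501518502503504477500497500500492499508517475511498501499501512500500510498502511491509509,
  514516511510507499486492501498499507494503502500506511495506481506501499479472519515502498497500503500505499498513477511499501511508501499495497502507502504505497510482495501506497496500504504484500503500504500500501505494501488499506494501500502498505490502526503505506477499496500500501498499525475504498501499501503499501502499502502499501501,
  516519513512509499484492501498499507493503502500506511493508480508501499477471464514502496497500505500507499495513479509500499510508501499493497502507504503507495507484495503503497495499501501487502505500504500501501503494501489499503497499501504498505491502527503504505474499496500500499498501526472504498501499501505499500503498502504498502502,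
  478480475484471499520503502498499496504505502500495502527490506467461500519502486500502490536480493500476518483498521518501493510512501499488516483512493527494491485530476510498497471482493484528510501498487500508503506484501516499482518502499498496488518511585505484490416508488496504506494493587413491503496496505509504495495495505504501499499,
  519521515527512499481504502498499495505494502500494490491534518511501499485523514513502494497500507500510498491511483507500497507507501499490497503507506503509493503487494505500498494498497499491504507500504500501501501494501490499499500497502506498506492502529503502503470500496500500498498503528468505499501499502508500500504498502506496504504,
  477479474484470499520503502498499496505505502500495502528490507466517500520503485499502488528484493500481515481498521520502490511514501499487512486515495526494490483532475511497497470482492483530510503498486500508503505483501517499480520502500499496488519512591505483489409508488495504506493494592406492503496495505511504495495494506506500500500,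
  516519513516510499483495501498499504497500502500502505493515473509501499480526518515502495497500511500508499491514478506500498507507501499490497502506505502513492505481495505502498496499498501486504506500508500500501501495501486499501498497503505498509488501522503505505477499497500500497498503521476507498501499501507499500505499502506496505505,
  481482494488505515517503486513480496505504487465494501497495509503503517517506473493469501496499498500504500465492538537501470522534501499477494501536503531500479466556464522484491451473481470554521514493483500518508498467501529499462538499501506491485530526692510469479297514474493506507486495697292491507493488512532508492498487513520494507507,
  520523516533512499480508502498499491472490502500528458491507483511501499488521512511502493497501505500510498491510486508500496507507501499490497503507507503507493501490493505500498493497497498494504508500502500501502501494501492499498502498502506498504494503533503501502466501495499501499498503532464503499500498502509500499503498503507496504504,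
  478479483485508507520504494527489495505505473522494501495493509506502509520506477494476499496499496500507500470493532532501474519529501498480494501531505526498482471548469518486492458476484474547518514494484500515507498472501525499467533499501506492486527523666509473482324512477493505506488497670320492506494490511528507493498489511517494506506,
  523527520512515498476482502498499517484456503500515473488498493514501499496516506507503491496501498500512498490506495509501494507508501498491497503508508504501494497500491505498498489495496495502505509499497500503502500492501499499494505498502507497499501505544504497499454502494498501500497503543452500500499497503510501498501497503507497503503,
  474476493482511522523504480520539495506505480517494502492490510509502501523505481496482496496500494500509499474495527527501478516525501498483495502526506521496486475541473515488494464480486478539515513495485500513506498476501521499473527500501507493487523519641508478485351510480494504505490498644347492505494491509524506494498490510515495504505,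
  474475470482465499524504502497499495506505503500493501473490510509501500524506482495502477494500494500508498474494526527505478516525501498483494502527504522496486475540474515489496466480485478539515511496485500511505499480501521499473527499502506494487523516617507478485376510484494504504491499620373492505495493508521506494497492508513496504504,
  522526519544514499478516502498499483518484503500520468489501490513501499493517508509502492496501501500512498490507492509501495507508501498491497503508508503503494499496491505499498490496496496499505509499499500502502500493501497499496504498502507497501498504540504498500458502494499501500497503539456501500499498503510501499502497503507497503504,
  471473462480513493526504508492505495506506487512493502490488510512501494526505485497489493496500492500511499479496522523502482513520501498486495502521508516494489480533477512490495470483489482532512513496486501510505498480501518499477523500501507494488520515617507482488376509484495504504491500619373493504495493508521505495498492508513496504504,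
  526530522498517498474529502498499508493474503500507484487493500516500499501512501505503490496501494500514498489503500511501493507509501498492496503509509504497495495506489505497498487494495493508505511498493501503503499491501503499492507499501508496496505506551504495497446503492498501501496503550444498501498497504511502498499496504508497502503,
  468469513477516486529505494506514494507507495506493502487486510515501486529505488499495491496501490500513498483498516518502486510515501498489496503516509511492492485525482509492496477487491486525509513497487501508504498485501514499483517500501508495489516512591506486491403507487496503504493501592400493503496494506517504495497493507511497503503,
  529471525477519498509503502497499496505502503500494499485485510518500499509507495501503488496501488501516498488499509512502490507510501498492496503510511505491496490516487506495498484491494491516506512498488501504503499490501509499489511500500508496491511507562505491494434505491497502503495503562432494502497496505513503497497495505508498501503]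

def EL : List (Fin 59 × Fin 59) := [
  (0,1), (0,2), (0,6), (1,3), (1,6), (1,8), (2,4), (2,7), (2,9), (3,5), (3,8), (3,10),
  (4,9), (4,11), (4,13), (5,10), (5,12), (5,14), (6,8), (6,15), (7,9), (7,15), (8,10), (9,11),
  (10,18), (11,13), (11,16), (12,14), (12,18), (12,19), (13,17), (13,20), (14,19), (14,21), (15,16), (15,23),
  (16,22), (16,23), (17,20), (17,22), (17,26), (18,24), (18,25), (19,21), (19,27), (20,26), (20,29), (21,27),
  (21,30), (22,26), (22,28), (23,25), (23,28), (24,25), (24,27), (24,34), (25,33), (26,29), (27,30), (28,35),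
  (28,36), (29,32), (29,38), (30,31), (30,37), (31,34), (31,37), (31,39), (32,36), (32,38), (32,41), (33,34),
  (33,35), (33,40), (34,40), (35,42), (35,43), (36,41), (36,42), (37,39), (37,44), (38,41), (38,45), (39,44),
  (39,46), (40,46), (40,48), (41,45), (42,43), (42,47), (43,51), (43,52), (44,46), (44,53), (45,47), (45,54),
  (46,53), (47,49), (47,54), (48,50), (48,55), (49,51), (49,54), (49,56), (50,52), (50,55), (50,57), (51,56),
  (51,58), (52,57), (53,55), (54,56), (55,57), (56,58), (57,58), (48,53), (52,58), (0,7)]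

def ent (N k : ℕ) : ℕ := Nat.mod (Nat.div N (Nat.pow 1000 k)) 1000

def crd (N i : ℕ) : ℕ := Nat.mod (Nat.div N (Nat.pow 1000000000000 i)) 1000000000000

def sumN (f : ℕ → ℕ) : ℕ → ℕ
  | 0 => 0
  | n + 1 => Nat.add (sumN f n) (f n)

def allN (f : ℕ → Bool) : ℕ → Bool
  | 0 => true
  | n + 1 => allN f n && f n

def ndist (a b : ℕ) : ℕ := Nat.add (Nat.sub a b) (Nat.sub b a)

def edg (j : ℕ) : Fin 59 × Fin 59 := EL.getD j (0, 0)

def rowX (i : ℕ) : ℕ := RX.getD i 0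

def rowY (i : ℕ) : ℕ := RY.getD i 0

def dot4 (a b c d e f g h : ℕ) : ℕ :=
  Nat.mul 2 (Nat.add (Nat.add (Nat.mul a b) (Nat.mul c d)) (Nat.add (Nat.mul e f) (Nat.mul g h)))

def linTerm (a b j k : ℕ) : ℕ :=
  ndist (Nat.add (bif Nat.beq k j then 11000000000000 else 0)
    (dot4 (crd CX a) (ent (rowX b) k) (crd CX b) (ent (rowX a) k)
          (crd CY a) (ent (rowY b) k) (crd CY b) (ent (rowY a) k)))
    (dot4 (crd CX a) (ent (rowX a) k) (crd CX b) (ent (rowX b) k)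
          (crd CY a) (ent (rowY a) k) (crd CY b) (ent (rowY b) k))

def sqd (a b : ℕ) : ℕ := Nat.add (Nat.pow (ndist (crd CX a) (crd CX b)) 2)
  (Nat.pow (ndist (crd CY a) (crd CY b)) 2)

def g1 (a c : ℕ) : Bool := Nat.ble (Nat.add (crd CX a) 6001) (crd CX c)
def g2 (a c : ℕ) : Bool := Nat.ble (Nat.add (crd CY a) 6001) (crd CY c)
def g3 (a c : ℕ) : Bool := Nat.ble (Nat.add (Nat.add (crd CX a) (crd CY a)) 12001)
  (Nat.add (crd CX c) (crd CY c))
def g4 (a c : ℕ) : Bool := Nat.ble (Nat.add (Nat.add (crd CX a) (crd CY c)) 12001)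
  (Nat.add (crd CX c) (crd CY a))

def sep (g : ℕ → ℕ → Bool) (e f : Fin 59 × Fin 59) : Bool :=
  g e.1 f.1 && g e.1 f.2 && g e.2 f.1 && g e.2 f.2

def sep2 (g : ℕ → ℕ → Bool) (e f : Fin 59 × Fin 59) : Bool := sep g e f || sep g f e

def gap (u v : ℤ) (a c : ℕ) : Bool :=
  decide (6000 * ((u.natAbs : ℤ) + (v.natAbs : ℤ)) <
    u * ((crd CX c : ℤ) - (crd CX a : ℤ)) + v * ((crd CY c : ℤ) - (crd CY a : ℤ)))

def wdg (u v : ℤ) (o a b : ℕ) : Bool := gap u v o b && gap u v a o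

def adj (o a b : ℕ) : Bool :=
  wdg ((crd CX b : ℤ) - crd CX a) ((crd CY b : ℤ) - crd CY a) o a b ||
  wdg (2 * (crd CY o : ℤ) - crd CY a - crd CY b) ((crd CX a : ℤ) + crd CX b - 2 * crd CX o) o a b ||
  wdg ((crd CY a : ℤ) + crd CY b - 2 * crd CY o) (2 * (crd CX o : ℤ) - crd CX a - crd CX b) o a b

def pairOK (e f : Fin 59 × Fin 59) : Bool :=
  bif Nat.beq e.1 f.1 then adj e.1 e.2 f.2 else
  bif Nat.beq e.1 f.2 then adj e.1 e.2 f.1 else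
  bif Nat.beq e.2 f.1 then adj e.2 e.1 f.2 else
  bif Nat.beq e.2 f.2 then adj e.2 e.1 f.1 else
  sep2 g1 e f || sep2 g2 e f || sep2 g3 e f || sep2 g4 e f

def allP (p : Fin 59 × Fin 59 → Fin 59 × Fin 59 → Bool) : List (Fin 59 × Fin 59) → Bool
  | [] => true
  | e :: l => l.all (p e) && allP p l

def neq (e f : Fin 59 × Fin 59) : Bool := !(Nat.beq e.1 f.1 && Nat.beq e.2 f.2)

theorem chk1 : allN (fun i => Nat.ble (sumN (fun k => ndist (ent (rowX i) k) 500) 115) 2970 &&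
    Nat.ble (sumN (fun k => ndist (ent (rowY i) k) 500) 115) 2970) 59 = true := by
  decide +kernel

theorem chk2 : allN (fun j => Nat.ble
    (sumN (fun k => linTerm (edg j).1 (edg j).2 j k) 115) 8800000000000) 115 = true := by
  decide +kernel

theorem chk3 : allN (fun j => Nat.ble (ndist (sqd (edg j).1 (edg j).2) (10 ^ 22)) (10 ^ 12)) 115
    = true := by
  decide +kernel

theorem chk4 : allP pairOK EL = true := by
  decide +kernel

theorem chk5 : allN (fun i => allN (fun j => g1 i j || g1 j i || g2 i j || g2 j i) i) 59
    = true := by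
  decide +kernel

theorem chk6 : (allP neq EL && Nat.beq EL.length 118 &&
    EL.all (fun e => Nat.blt e.1 e.2)) = true := by
  decide +kernel

theorem chk7 : ∀ v : Fin 59,
    (EL.filter (fun e => decide (e.1 = v) || decide (e.2 = v))).length = 4 := by
  decide +kernel

theorem chk8 : ∀ e ∈ EL.drop 115, 10 ^ 20 < ndist (sqd e.1 e.2) (10 ^ 22) ∧
    ndist (sqd e.1 e.2) (10 ^ 22) < 5 * 10 ^ 20 := by
  decide +kernel

theorem lin_bound {n : ℕ} (c y : Fin n → ℝ) (C : ℝ) (hc : ∑ k, |c k| ≤ C) :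
    |∑ k, c k * y k| ≤ C * ‖y‖ := by
  calc |∑ k, c k * y k| ≤ ∑ k, |c k * y k| := Finset.abs_sum_le_sum_abs _ _
    _ ≤ ∑ k, |c k| * ‖y‖ := by
        apply Finset.sum_le_sum
        intro k _
        rw [abs_mul]
        exact mul_le_mul_of_nonneg_left (norm_le_pi_norm y k) (abs_nonneg _)
    _ = (∑ k, |c k|) * ‖y‖ := by rw [Finset.sum_mul]
    _ ≤ C * ‖y‖ := mul_le_mul_of_nonneg_right hc (norm_nonneg _)

theorem newton {n m : ℕ} (X Y : Fin m → ℝ) (AX AY : Fin m → Fin n → ℝ)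
    (e : Fin n → Fin m × Fin m)
    (hAX : ∀ i, ∑ k, |AX i k| ≤ 27) (hAY : ∀ i, ∑ k, |AY i k| ≤ 27)
    (hF : ∀ j, |(X (e j).1 - X (e j).2) ^ 2 + (Y (e j).1 - Y (e j).2) ^ 2 - 1| ≤ 1 / 10 ^ 10)
    (hJ : ∀ j, ∑ k, |(if k = j then 1 else 0)
        - 2 * (X (e j).1 - X (e j).2) * (AX (e j).1 k - AX (e j).2 k)
        - 2 * (Y (e j).1 - Y (e j).2) * (AY (e j).1 k - AY (e j).2 k)| ≤ 4 / 5) :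
    ∃ px py : Fin m → ℝ, (∀ i, |px i - X i| ≤ 27 / 10 ^ 9) ∧ (∀ i, |py i - Y i| ≤ 27 / 10 ^ 9) ∧
      ∀ j, (px (e j).1 - px (e j).2) ^ 2 + (py (e j).1 - py (e j).2) ^ 2 = 1 := by
  let hx : (Fin n → ℝ) → Fin m → ℝ := fun y i => ∑ k, AX i k * y k
  let hy : (Fin n → ℝ) → Fin m → ℝ := fun y i => ∑ k, AY i k * y k
  have hxb : ∀ y i, |hx y i| ≤ 27 * ‖y‖ := fun y i => lin_bound _ _ _ (hAX i)
  have hyb : ∀ y i, |hy y i| ≤ 27 * ‖y‖ := fun y i => lin_bound _ _ _ (hAY i)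
  have hxs : ∀ y z i, hx (y - z) i = hx y i - hx z i := by
    intro y z i
    simp only [hx, Pi.sub_apply, mul_sub, Finset.sum_sub_distrib]
  have hys : ∀ y z i, hy (y - z) i = hy y i - hy z i := by
    intro y z i
    simp only [hy, Pi.sub_apply, mul_sub, Finset.sum_sub_distrib]
  let T : (Fin n → ℝ) → (Fin n → ℝ) := fun y j => y j -
    ((X (e j).1 + hx y (e j).1 - (X (e j).2 + hx y (e j).2)) ^ 2 +
     (Y (e j).1 + hy y (e j).1 - (Y (e j).2 + hy y (e j).2)) ^ 2 - 1)
  have key : ∀ y z : Fin n → ℝ, ‖y‖ ≤ 1 / 10 ^ 9 → ‖z‖ ≤ 1 / 10 ^ 9 →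
      ‖T y - T z‖ ≤ 9 / 10 * ‖y - z‖ := by
    intro y z hy1 hz1
    rw [pi_norm_le_iff_of_nonneg (by positivity)]
    intro j
    have h1 := lin_bound _ (y - z) _ (hJ j)
    have h2 : ∑ k, ((if k = j then 1 else 0)
        - 2 * (X (e j).1 - X (e j).2) * (AX (e j).1 k - AX (e j).2 k)
        - 2 * (Y (e j).1 - Y (e j).2) * (AY (e j).1 k - AY (e j).2 k)) * (y - z) k
        = (y - z) j - 2 * (X (e j).1 - X (e j).2) * (hx (y - z) (e j).1 - hx (y - z) (e j).2)
          - 2 * (Y (e j).1 - Y (e j).2) * (hy (y - z) (e j).1 - hy (y - z) (e j).2) := by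
      simp only [hx, hy, ← Finset.sum_sub_distrib, Finset.mul_sum]
      rw [show (y - z) j = ∑ k, (if k = j then 1 else 0) * (y - z) k by simp]
      rw [← Finset.sum_sub_distrib, ← Finset.sum_sub_distrib]
      apply Finset.sum_congr rfl
      intro k _
      ring
    rw [h2] at h1
    have hq : ∀ (s t d : ℝ), |s| ≤ 54 * d → |t| ≤ 108 / 10 ^ 9 → 0 ≤ d →
        |s * t| ≤ 1 / 100 * d := by
      intro s t d hs ht hd
      rw [abs_mul]
      calc |s| * |t| ≤ (54 * d) * (108 / 10 ^ 9) :=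
            mul_le_mul hs ht (abs_nonneg _) (by positivity)
        _ ≤ 1 / 100 * d := by nlinarith
    have hd := norm_nonneg (y - z)
    have qx := hq (hx (y - z) (e j).1 - hx (y - z) (e j).2)
      (hx y (e j).1 - hx y (e j).2 + (hx z (e j).1 - hx z (e j).2)) ‖y - z‖ (by
        have a1 := abs_le.1 (hxb (y - z) (e j).1)
        have a2 := abs_le.1 (hxb (y - z) (e j).2)
        rw [abs_le]; constructor <;> linarith [a1.1, a1.2, a2.1, a2.2]) (by
        have a1 := abs_le.1 (hxb y (e j).1)
        have a2 := abs_le.1 (hxb y (e j).2)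
        have a3 := abs_le.1 (hxb z (e j).1)
        have a4 := abs_le.1 (hxb z (e j).2)
        rw [abs_le]; constructor <;>
          linarith [a1.1, a1.2, a2.1, a2.2, a3.1, a3.2, a4.1, a4.2]) hd
    have qy := hq (hy (y - z) (e j).1 - hy (y - z) (e j).2)
      (hy y (e j).1 - hy y (e j).2 + (hy z (e j).1 - hy z (e j).2)) ‖y - z‖ (by
        have a1 := abs_le.1 (hyb (y - z) (e j).1)
        have a2 := abs_le.1 (hyb (y - z) (e j).2)
        rw [abs_le]; constructor <;> linarith [a1.1, a1.2, a2.1, a2.2]) (by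
        have a1 := abs_le.1 (hyb y (e j).1)
        have a2 := abs_le.1 (hyb y (e j).2)
        have a3 := abs_le.1 (hyb z (e j).1)
        have a4 := abs_le.1 (hyb z (e j).2)
        rw [abs_le]; constructor <;>
          linarith [a1.1, a1.2, a2.1, a2.2, a3.1, a3.2, a4.1, a4.2]) hd
    have h3 : (T y - T z) j = ((y - z) j
          - 2 * (X (e j).1 - X (e j).2) * (hx (y - z) (e j).1 - hx (y - z) (e j).2)
          - 2 * (Y (e j).1 - Y (e j).2) * (hy (y - z) (e j).1 - hy (y - z) (e j).2))
        - (hx (y - z) (e j).1 - hx (y - z) (e j).2) *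
          (hx y (e j).1 - hx y (e j).2 + (hx z (e j).1 - hx z (e j).2))
        - (hy (y - z) (e j).1 - hy (y - z) (e j).2) *
          (hy y (e j).1 - hy y (e j).2 + (hy z (e j).1 - hy z (e j).2)) := by
      simp only [hxs, hys, T, Pi.sub_apply]
      ring
    rw [h3, Real.norm_eq_abs]
    rw [abs_le] at h1 qx qy ⊢
    constructor <;> linarith [h1.1, h1.2, qx.1, qx.2, qy.1, qy.2]
  have T0 : ‖T 0‖ ≤ 1 / 10 ^ 10 := by
    rw [pi_norm_le_iff_of_nonneg (by positivity)]
    intro j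
    have h := hF j
    have : T 0 j = - ((X (e j).1 - X (e j).2) ^ 2 + (Y (e j).1 - Y (e j).2) ^ 2 - 1) := by
      simp [T, hx, hy]
    rw [this, norm_neg]
    exact h
  have maps : Set.MapsTo T (Metric.closedBall 0 (1 / 10 ^ 9)) (Metric.closedBall 0 (1 / 10 ^ 9)) := by
    intro y hy1
    rw [mem_closedBall_zero_iff] at hy1 ⊢
    have h1 := key y 0 hy1 (by simp)
    have h2 : ‖T y‖ ≤ ‖T y - T 0‖ + ‖T 0‖ := by
      simpa using norm_add_le (T y - T 0) (T 0)
    rw [sub_zero] at h1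
    linarith
  have hcon : ContractingWith (9 / 10 : NNReal) (maps.restrict T _ _) := by
    constructor
    · rw [← NNReal.coe_lt_coe]; norm_num
    · apply LipschitzWith.of_dist_le_mul
      rintro ⟨y, hy1⟩ ⟨z, hz1⟩
      rw [mem_closedBall_zero_iff] at hy1 hz1
      have := key y z hy1 hz1
      rw [Subtype.dist_eq, Subtype.dist_eq, dist_eq_norm, dist_eq_norm]
      simpa using this
  obtain ⟨y, hy1, hfix, -⟩ := ContractingWith.exists_fixedPoint'
    (Metric.isClosed_closedBall.isComplete) maps hcon (x := 0) (by simp) (edist_ne_top _ _)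
  rw [mem_closedBall_zero_iff] at hy1
  refine ⟨fun i => X i + hx y i, fun i => Y i + hy y i, ?_, ?_, ?_⟩
  · intro i
    have := hxb y i
    simp only [add_sub_cancel_left]
    linarith
  · intro i
    have := hyb y i
    simp only [add_sub_cancel_left]
    linarith
  · intro j
    have := congrFun hfix j
    simp only [T] at this
    linarith

theorem allN_spec {f : ℕ → Bool} : ∀ {n : ℕ}, allN f n = true → ∀ i < n, f i = true
  | 0, _, i, hi => absurd hi (Nat.not_lt_zero i)
  | n + 1, h, i, hi => by
    rw [allN, Bool.and_eq_true] at h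
    rcases Nat.lt_succ_iff_lt_or_eq.1 hi with h1 | h1
    · exact allN_spec h.1 i h1
    · rw [h1]; exact h.2

theorem sumN_eq (f : ℕ → ℕ) : ∀ n : ℕ, sumN f n = ∑ k : Fin n, f k
  | 0 => by simp [sumN]
  | n + 1 => by
    rw [Fin.sum_univ_castSucc, sumN, sumN_eq f n]
    rfl

theorem ndist_cast (a b : ℕ) : (ndist a b : ℝ) = |(a : ℝ) - b| := by
  have : ndist a b = (a - b) + (b - a) := rfl
  rw [this]
  rcases le_total a b with h | h
  · have h' : (a : ℝ) ≤ b := by exact_mod_cast h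
    rw [abs_of_nonpos (by linarith), Nat.sub_eq_zero_of_le h, Nat.cast_add, Nat.cast_sub h]
    push_cast; ring
  · have h' : (b : ℝ) ≤ a := by exact_mod_cast h
    rw [abs_of_nonneg (by linarith), Nat.sub_eq_zero_of_le h, Nat.cast_add, Nat.cast_sub h]
    push_cast; ring

theorem sqd_cast (a b : ℕ) : (sqd a b : ℝ) =
    ((crd CX a : ℝ) - crd CX b) ^ 2 + ((crd CY a : ℝ) - crd CY b) ^ 2 := by
  have : sqd a b = (ndist (crd CX a) (crd CX b)) ^ 2 + (ndist (crd CY a) (crd CY b)) ^ 2 := rfl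
  rw [this]
  push_cast
  rw [ndist_cast, ndist_cast, sq_abs, sq_abs]

theorem dot4_cast (a b c d e f g h : ℕ) : (dot4 a b c d e f g h : ℝ) =
    2 * ((a : ℝ) * b + c * d + (e * f + g * h)) := by
  have : dot4 a b c d e f g h = 2 * (a * b + c * d + (e * f + g * h)) := rfl
  rw [this]
  push_cast
  ring

theorem linTerm_cast (a b j k : ℕ) : (linTerm a b j k : ℝ) = |(if k = j then 11000000000000 else 0)
    - 2 * ((crd CX a : ℝ) - crd CX b) * ((ent (rowX a) k : ℝ) - ent (rowX b) k)
    - 2 * ((crd CY a : ℝ) - crd CY b) * ((ent (rowY a) k : ℝ) - ent (rowY b) k)| := by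
  rw [linTerm, ndist_cast]
  have hc : ∀ x y : ℕ, ((Nat.add x y : ℕ) : ℝ) = (x : ℝ) + y := fun x y => Nat.cast_add x y
  rw [hc, dot4_cast, dot4_cast]
  have hb : (((bif Nat.beq k j then 11000000000000 else 0 : ℕ)) : ℝ)
      = if k = j then 11000000000000 else 0 := by
    by_cases h : k = j
    · simp [h]
    · have : Nat.beq k j = false := by
        rw [← Bool.not_eq_true]; exact fun h' => h (Nat.eq_of_beq_eq_true h')
      simp [h, this]
  rw [hb]
  congr 1
  ring

theorem exists_pos : ∃ px py : Fin 59 → ℝ,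
    (∀ i : Fin 59, |px i - (crd CX i : ℝ)| ≤ 2700) ∧
    (∀ i : Fin 59, |py i - (crd CY i : ℝ)| ≤ 2700) ∧
    ∀ j < 115, (px (edg j).1 - px (edg j).2) ^ 2 + (py (edg j).1 - py (edg j).2) ^ 2 = 10 ^ 22 := by
  have hrow : ∀ (r : ℕ → ℕ) (i : ℕ), Nat.ble (sumN (fun k => ndist (ent (r i) k) 500) 115) 2970 = true →
      ∑ k : Fin 115, |((ent (r i) k : ℝ) - 500) / 110| ≤ 27 := by
    intro r i h
    have h := Nat.le_of_ble_eq_true h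
    rw [sumN_eq] at h
    have h : ((∑ k : Fin 115, ndist (ent (r i) k) 500 : ℕ) : ℝ) ≤ (2970 : ℕ) := by exact_mod_cast h
    simp only [Nat.cast_sum, ndist_cast] at h
    have h2 : ∀ k : Fin 115, |((ent (r i) k : ℝ) - 500) / 110|
        = |((ent (r i) k : ℝ) - (500 : ℕ))| / 110 := by
      intro k
      rw [abs_div, abs_of_pos (by norm_num : (0 : ℝ) < 110)]
      norm_num
    simp only [h2]
    rw [← Finset.sum_div]
    rw [div_le_iff₀ (by norm_num)]
    norm_num at h ⊢
    exact h
  obtain ⟨px, py, h1, h2, h3⟩ := newton (n := 115) (m := 59)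
    (fun i => (crd CX i : ℝ) / 10 ^ 11) (fun i => (crd CY i : ℝ) / 10 ^ 11)
    (fun i k => ((ent (rowX i) k : ℝ) - 500) / 110) (fun i k => ((ent (rowY i) k : ℝ) - 500) / 110)
    (fun j => edg j)
    (by
      intro i
      have h := allN_spec chk1 i i.2
      rw [Bool.and_eq_true] at h
      exact hrow rowX i h.1)
    (by
      intro i
      have h := allN_spec chk1 i i.2
      rw [Bool.and_eq_true] at h
      exact hrow rowY i h.2)
    (by
      intro j
      have h := allN_spec chk3 j j.2
      have h := Nat.le_of_ble_eq_true h
      have h : ((ndist (sqd (edg j).1 (edg j).2) (10 ^ 22) : ℕ) : ℝ) ≤ ((10 ^ 12 : ℕ) : ℝ) := by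
        exact_mod_cast h
      rw [ndist_cast, sqd_cast] at h
      push_cast at h
      generalize (crd CX (edg j).1 : ℝ) = a at h ⊢
      generalize (crd CX (edg j).2 : ℝ) = b at h ⊢
      generalize (crd CY (edg j).1 : ℝ) = c at h ⊢
      generalize (crd CY (edg j).2 : ℝ) = d at h ⊢
      have e1 : (a / 10 ^ 11 - b / 10 ^ 11) ^ 2 + (c / 10 ^ 11 - d / 10 ^ 11) ^ 2 - 1
        = ((a - b) ^ 2 + (c - d) ^ 2 - 10 ^ 22) / 10 ^ 22 := by ring
      show |(a / 10 ^ 11 - b / 10 ^ 11) ^ 2 + (c / 10 ^ 11 - d / 10 ^ 11) ^ 2 - 1| ≤ 1 / 10 ^ 10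
      rw [e1, abs_div, abs_of_pos (by norm_num : (0 : ℝ) < 10 ^ 22), div_le_iff₀ (by norm_num)]
      linarith)
    (by
      intro j
      have h := allN_spec chk2 j j.2
      have h := Nat.le_of_ble_eq_true h
      rw [sumN_eq] at h
      have h : ((∑ k : Fin 115, linTerm (edg j).1 (edg j).2 j k : ℕ) : ℝ)
          ≤ ((8800000000000 : ℕ) : ℝ) := by exact_mod_cast h
      rw [Nat.cast_sum] at h
      have h4 : ∀ k : Fin 115, |(if k = j then (1 : ℝ) else 0)
          - 2 * ((crd CX (edg j).1 : ℝ) / 10 ^ 11 - (crd CX (edg j).2 : ℝ) / 10 ^ 11) *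
            (((ent (rowX (edg j).1) k : ℝ) - 500) / 110 - ((ent (rowX (edg j).2) k : ℝ) - 500) / 110)
          - 2 * ((crd CY (edg j).1 : ℝ) / 10 ^ 11 - (crd CY (edg j).2 : ℝ) / 10 ^ 11) *
            (((ent (rowY (edg j).1) k : ℝ) - 500) / 110 - ((ent (rowY (edg j).2) k : ℝ) - 500) / 110)|
          = (linTerm (edg j).1 (edg j).2 j k : ℝ) / 11000000000000 := by
        intro k
        rw [linTerm_cast, ← abs_of_pos (by norm_num : (0 : ℝ) < 11000000000000), ← abs_div]
        congr 1
        rw [abs_of_pos (by norm_num : (0 : ℝ) < 11000000000000)]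
        simp only [Fin.ext_iff]
        split_ifs <;> ring
      refine le_of_eq_of_le (Finset.sum_congr rfl fun k _ => h4 k) ?_
      rw [← Finset.sum_div, div_le_iff₀ (by norm_num)]
      refine h.trans ?_
      norm_num)
  refine ⟨fun i => px i * 10 ^ 11, fun i => py i * 10 ^ 11, ?_, ?_, ?_⟩
  · intro i
    have := abs_le.1 (h1 i)
    rw [abs_le]
    constructor <;> linarith [this.1, this.2]
  · intro i
    have := abs_le.1 (h2 i)
    rw [abs_le]
    constructor <;> linarith [this.1, this.2]
  · intro j hj
    have := h3 ⟨j, hj⟩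
    simp only at this
    simp only [← sub_mul, mul_pow]
    rw [← add_mul, this]
    norm_num

theorem seg_lin {ℓ : EuclideanSpace ℝ (Fin 2) → ℝ}
    (hℓ : ∀ (s t : ℝ) p q, ℓ (s • p + t • q) = s * ℓ p + t * ℓ q)
    {a b x : EuclideanSpace ℝ (Fin 2)} (hx : x ∈ segment ℝ a b) :
    (ℓ x ≤ ℓ a ∨ ℓ x ≤ ℓ b) ∧ (ℓ a ≤ ℓ x ∨ ℓ b ≤ ℓ x) := by
  obtain ⟨s, t, hs, ht, hst, rfl⟩ := hx
  rw [hℓ]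
  have : s = 1 - t := by linarith
  subst this
  constructor
  · rcases le_total (ℓ a) (ℓ b) with h | h
    · right; nlinarith
    · left; nlinarith
  · rcases le_total (ℓ a) (ℓ b) with h | h
    · left; nlinarith
    · right; nlinarith

theorem seg_sep {ℓ : EuclideanSpace ℝ (Fin 2) → ℝ}
    (hℓ : ∀ (s t : ℝ) p q, ℓ (s • p + t • q) = s * ℓ p + t * ℓ q)
    {a b c d x : EuclideanSpace ℝ (Fin 2)} (hx : x ∈ segment ℝ a b) (hy : x ∈ segment ℝ c d)
    (h1 : ℓ a < ℓ c) (h2 : ℓ a < ℓ d) (h3 : ℓ b < ℓ c) (h4 : ℓ b < ℓ d) : False := by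
  have h5 := (seg_lin hℓ hx).1
  have h6 := (seg_lin hℓ hy).2
  rcases h5 with h5 | h5 <;> rcases h6 with h6 | h6 <;> linarith

theorem seg_wdg {ℓ : EuclideanSpace ℝ (Fin 2) → ℝ}
    (hℓ : ∀ (s t : ℝ) p q, ℓ (s • p + t • q) = s * ℓ p + t * ℓ q)
    {o a b x : EuclideanSpace ℝ (Fin 2)} (hx : x ∈ segment ℝ o a) (hy : x ∈ segment ℝ o b)
    (h1 : ℓ a < ℓ o) (h2 : ℓ o < ℓ b) : x = o := by
  have h6 := (seg_lin hℓ hy).2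
  obtain ⟨s, t, hs, ht, hst, rfl⟩ := hx
  rw [hℓ] at h6
  have : s = 1 - t := by linarith
  subst this
  have ht0 : t = 0 := by
    rcases h6 with h6 | h6 <;> nlinarith
  subst ht0
  simp

/-- The linear functional with integer coefficients. -/
noncomputable def lf (u v : ℤ) (p : EuclideanSpace ℝ (Fin 2)) : ℝ := u * p 0 + v * p 1

theorem lf_lin (u v : ℤ) (s t : ℝ) (p q : EuclideanSpace ℝ (Fin 2)) :
    lf u v (s • p + t • q) = s * lf u v p + t * lf u v q := by
  simp only [lf, PiLp.add_apply, PiLp.smul_apply, smul_eq_mul]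
  ring

/-- The points are close to the tabulated ones (in units of `10 ^ (-11)`). -/
def Close (P : Fin 59 → EuclideanSpace ℝ (Fin 2)) : Prop :=
  ∀ i : Fin 59, |10 ^ 11 * P i 0 - (crd CX i : ℝ)| ≤ 2700 ∧ |10 ^ 11 * P i 1 - (crd CY i : ℝ)| ≤ 2700

/-- Soundness of a direction test. -/
def Sound (P : Fin 59 → EuclideanSpace ℝ (Fin 2)) (u v : ℤ) (g : ℕ → ℕ → Bool) : Prop :=
  ∀ a c : Fin 59, g a c = true → lf u v (P a) < lf u v (P c)

theorem gap_sound' {P : Fin 59 → EuclideanSpace ℝ (Fin 2)} (hP : Close P) (u v : ℤ) (a c : Fin 59)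
    (h : 6000 * ((u.natAbs : ℤ) + (v.natAbs : ℤ)) <
      u * ((crd CX c : ℤ) - (crd CX a : ℤ)) + v * ((crd CY c : ℤ) - (crd CY a : ℤ))) :
    lf u v (P a) < lf u v (P c) := by
  have h : (6000 : ℝ) * (|(u : ℝ)| + |(v : ℝ)|) <
      u * ((crd CX c : ℝ) - (crd CX a : ℝ)) + v * ((crd CY c : ℝ) - (crd CY a : ℝ)) := by
    rw [Int.natCast_natAbs, Int.natCast_natAbs] at h
    exact_mod_cast h
  obtain ⟨ha0, ha1⟩ := hP a
  obtain ⟨hc0, hc1⟩ := hP c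
  simp only [lf]
  generalize P a 0 = a0 at *
  generalize P a 1 = a1 at *
  generalize P c 0 = c0 at *
  generalize P c 1 = c1 at *
  have hb : ∀ w s t x y : ℝ, |s - x| ≤ 2700 → |t - y| ≤ 2700 →
      w * (y - x) - 6000 * |w| ≤ w * (t - s) := by
    intro w s t x y h1 h2
    rw [abs_le] at h1 h2
    have h3 : |w * ((y - x) - (t - s))| ≤ |w| * 6000 := by
      rw [abs_mul]
      apply mul_le_mul_of_nonneg_left _ (abs_nonneg w)
      rw [abs_le]
      constructor <;> linarith [h1.1, h1.2, h2.1, h2.2]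
    have h4 := (abs_le.1 h3).2
    linarith
  have e1 := hb u _ _ _ _ ha0 hc0
  have e2 := hb v _ _ _ _ ha1 hc1
  linarith

theorem gap_sound {P : Fin 59 → EuclideanSpace ℝ (Fin 2)} (hP : Close P) (u v : ℤ) :
    Sound P u v (gap u v) := fun a c h => gap_sound' hP u v a c (of_decide_eq_true h)

theorem g1_sound {P : Fin 59 → EuclideanSpace ℝ (Fin 2)} (hP : Close P) : Sound P 1 0 g1 := by
  intro a c h
  apply gap_sound' hP
  have h : crd CX a + 6001 ≤ crd CX c := Nat.le_of_ble_eq_true h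
  norm_num
  omega

theorem g2_sound {P : Fin 59 → EuclideanSpace ℝ (Fin 2)} (hP : Close P) : Sound P 0 1 g2 := by
  intro a c h
  apply gap_sound' hP
  have h : crd CY a + 6001 ≤ crd CY c := Nat.le_of_ble_eq_true h
  norm_num
  omega

theorem g3_sound {P : Fin 59 → EuclideanSpace ℝ (Fin 2)} (hP : Close P) : Sound P 1 1 g3 := by
  intro a c h
  apply gap_sound' hP
  have h : crd CX a + crd CY a + 12001 ≤ crd CX c + crd CY c := Nat.le_of_ble_eq_true h
  norm_num
  omega

theorem g4_sound {P : Fin 59 → EuclideanSpace ℝ (Fin 2)} (hP : Close P) : Sound P 1 (-1) g4 := by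
  intro a c h
  apply gap_sound' hP
  have h : crd CX a + crd CY c + 12001 ≤ crd CX c + crd CY a := Nat.le_of_ble_eq_true h
  norm_num
  omega

theorem sep_sound {P : Fin 59 → EuclideanSpace ℝ (Fin 2)} {u v : ℤ} {g : ℕ → ℕ → Bool}
    (hg : Sound P u v g) {e f : Fin 59 × Fin 59} (h : sep g e f = true)
    {x : EuclideanSpace ℝ (Fin 2)} (hx : x ∈ segment ℝ (P e.1) (P e.2))
    (hy : x ∈ segment ℝ (P f.1) (P f.2)) : False := by
  simp only [sep, Bool.and_eq_true] at h
  exact seg_sep (lf_lin u v) hx hy (hg _ _ h.1.1.1) (hg _ _ h.1.1.2) (hg _ _ h.1.2) (hg _ _ h.2)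

theorem sep2_sound {P : Fin 59 → EuclideanSpace ℝ (Fin 2)} {u v : ℤ} {g : ℕ → ℕ → Bool}
    (hg : Sound P u v g) {e f : Fin 59 × Fin 59} (h : sep2 g e f = true)
    {x : EuclideanSpace ℝ (Fin 2)} (hx : x ∈ segment ℝ (P e.1) (P e.2))
    (hy : x ∈ segment ℝ (P f.1) (P f.2)) : False := by
  rw [sep2, Bool.or_eq_true] at h
  rcases h with h | h
  · exact sep_sound hg h hx hy
  · exact sep_sound hg h hy hx

theorem adj_sound {P : Fin 59 → EuclideanSpace ℝ (Fin 2)} (hP : Close P) {o a b : Fin 59}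
    (h : adj o a b = true) {x : EuclideanSpace ℝ (Fin 2)} (hx : x ∈ segment ℝ (P o) (P a))
    (hy : x ∈ segment ℝ (P o) (P b)) : x = P o := by
  have hw : ∀ u v : ℤ, wdg u v o a b = true → x = P o := by
    intro u v h
    rw [wdg, Bool.and_eq_true] at h
    exact seg_wdg (lf_lin u v) hx hy (gap_sound hP u v _ _ h.2) (gap_sound hP u v _ _ h.1)
  rw [adj, Bool.or_eq_true, Bool.or_eq_true] at h
  rcases h with (h | h) | h <;> exact hw _ _ h

theorem beq_fin {a b : Fin 59} (h : Nat.beq a b = true) : a = b :=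
  Fin.ext (Nat.eq_of_beq_eq_true h)

theorem pair_sound {P : Fin 59 → EuclideanSpace ℝ (Fin 2)} (hP : Close P) {e f : Fin 59 × Fin 59}
    (h : pairOK e f = true) {x : EuclideanSpace ℝ (Fin 2)} (hx : x ∈ segment ℝ (P e.1) (P e.2))
    (hy : x ∈ segment ℝ (P f.1) (P f.2)) :
    (x = P e.1 ∨ x = P e.2) ∧ (x = P f.1 ∨ x = P f.2) := by
  rw [pairOK] at h
  cases h1 : Nat.beq e.1 f.1
  · rw [h1, cond_false] at h
    cases h2 : Nat.beq e.1 f.2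
    · rw [h2, cond_false] at h
      cases h3 : Nat.beq e.2 f.1
      · rw [h3, cond_false] at h
        cases h4 : Nat.beq e.2 f.2
        · rw [h4, cond_false, Bool.or_eq_true, Bool.or_eq_true, Bool.or_eq_true] at h
          exfalso
          rcases h with ((h | h) | h) | h
          · exact sep2_sound (g1_sound hP) h hx hy
          · exact sep2_sound (g2_sound hP) h hx hy
          · exact sep2_sound (g3_sound hP) h hx hy
          · exact sep2_sound (g4_sound hP) h hx hy
        · rw [h4, cond_true] at h
          have e4 := beq_fin h4
          rw [segment_symm] at hx hy
          rw [← e4] at hy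
          have := adj_sound hP h hx hy
          exact ⟨Or.inr this, Or.inr (e4 ▸ this)⟩
      · rw [h3, cond_true] at h
        have e4 := beq_fin h3
        rw [segment_symm] at hx
        rw [← e4] at hy
        have := adj_sound hP h hx hy
        exact ⟨Or.inr this, Or.inl (e4 ▸ this)⟩
    · rw [h2, cond_true] at h
      have e4 := beq_fin h2
      rw [segment_symm] at hy
      rw [← e4] at hy
      have := adj_sound hP h hx hy
      exact ⟨Or.inl this, Or.inr (e4 ▸ this)⟩
  · rw [h1, cond_true] at h
    have e4 := beq_fin h1
    rw [← e4] at hy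
    have := adj_sound hP h hx hy
    exact ⟨Or.inl this, Or.inl (e4 ▸ this)⟩

theorem allP_spec {p : Fin 59 × Fin 59 → Fin 59 × Fin 59 → Bool} :
    ∀ {l : List (Fin 59 × Fin 59)}, allP p l = true → l.Pairwise (fun e f => p e f = true)
  | [], _ => List.Pairwise.nil
  | e :: l, h => by
    rw [allP, Bool.and_eq_true, List.all_eq_true] at h
    exact List.Pairwise.cons h.1 (allP_spec h.2)

theorem EL_nodup : EL.Nodup := by
  have h := chk6
  rw [Bool.and_eq_true, Bool.and_eq_true] at h
  refine (allP_spec h.1.1).imp ?_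
  rintro e f hne rfl
  simp [neq] at hne

theorem EL_length : EL.length = 118 := by
  have h := chk6
  rw [Bool.and_eq_true, Bool.and_eq_true] at h
  exact Nat.eq_of_beq_eq_true h.1.2

theorem EL_lt : ∀ e ∈ EL, e.1 < e.2 := by
  have h := chk6
  rw [Bool.and_eq_true, Bool.and_eq_true, List.all_eq_true] at h
  intro e he
  exact Nat.le_of_ble_eq_true (h.2 e he)

theorem inj_sound {P : Fin 59 → EuclideanSpace ℝ (Fin 2)} (hP : Close P) : Function.Injective P := by
  have hlt : ∀ i j : Fin 59, j < i → P i ≠ P j := by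
    intro i j hij he
    have h := allN_spec (allN_spec chk5 i i.2) j hij
    rw [Bool.or_eq_true, Bool.or_eq_true, Bool.or_eq_true] at h
    rcases h with ((h | h) | h) | h
    · have := g1_sound hP _ _ h; rw [he] at this; exact lt_irrefl _ this
    · have := g1_sound hP _ _ h; rw [he] at this; exact lt_irrefl _ this
    · have := g2_sound hP _ _ h; rw [he] at this; exact lt_irrefl _ this
    · have := g2_sound hP _ _ h; rw [he] at this; exact lt_irrefl _ this
  intro i j he
  rcases lt_trichotomy i j with h | h | h
  · exact absurd he.symm (hlt j i h)
  · exact h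
  · exact absurd he (hlt i j h)

theorem dist_ex {P : Fin 59 → EuclideanSpace ℝ (Fin 2)} (hP : Close P) (e : Fin 59 × Fin 59)
    (h1 : 10 ^ 20 < ndist (sqd e.1 e.2) (10 ^ 22))
    (h2 : ndist (sqd e.1 e.2) (10 ^ 22) < 5 * 10 ^ 20) :
    dist (P e.1) (P e.2) ≠ 1 ∧ |dist (P e.1) (P e.2) - 1| < 0.03 := by
  have h1 : ((10 ^ 20 : ℕ) : ℝ) < (ndist (sqd e.1 e.2) (10 ^ 22) : ℝ) := by exact_mod_cast h1
  have h2 : (ndist (sqd e.1 e.2) (10 ^ 22) : ℝ) < ((5 * 10 ^ 20 : ℕ) : ℝ) := by exact_mod_cast h2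
  rw [ndist_cast, sqd_cast] at h1 h2
  push_cast at h1 h2
  have hd : dist (P e.1) (P e.2) ^ 2 = (P e.1 0 - P e.2 0) ^ 2 + (P e.1 1 - P e.2 1) ^ 2 := by
    rw [EuclideanSpace.dist_eq, Real.sq_sqrt (by positivity), Fin.sum_univ_two,
      Real.dist_eq, Real.dist_eq, sq_abs, sq_abs]
  have hd0 : 0 ≤ dist (P e.1) (P e.2) := dist_nonneg
  generalize dist (P e.1) (P e.2) = d at *
  obtain ⟨ha0, ha1⟩ := hP e.1
  obtain ⟨hc0, hc1⟩ := hP e.2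
  generalize P e.1 0 = a0 at *
  generalize P e.1 1 = a1 at *
  generalize P e.2 0 = c0 at *
  generalize P e.2 1 = c1 at *
  generalize (crd CX e.1 : ℝ) = x0 at *
  generalize (crd CY e.1 : ℝ) = y0 at *
  generalize (crd CX e.2 : ℝ) = x1 at *
  generalize (crd CY e.2 : ℝ) = y1 at *
  have hX : (x0 - x1) ^ 2 ≤ (2 * 10 ^ 11) ^ 2 := by
    have := (abs_lt.1 h2).2
    nlinarith [sq_nonneg (y0 - y1)]
  have hY : (y0 - y1) ^ 2 ≤ (2 * 10 ^ 11) ^ 2 := by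
    have := (abs_lt.1 h2).2
    nlinarith [sq_nonneg (x0 - x1)]
  have hX := abs_le_of_sq_le_sq hX (by norm_num)
  have hY := abs_le_of_sq_le_sq hY (by norm_num)
  have hsq : ∀ U V : ℝ, |U| ≤ 2 * 10 ^ 11 → |V - U| ≤ 5400 → |V ^ 2 - U ^ 2| ≤ 10 ^ 16 := by
    intro U V hU hV
    have e1 : V ^ 2 - U ^ 2 = (V - U) * (V + U) := by ring
    have e2 : |V + U| ≤ 5 * 10 ^ 11 := by
      rw [abs_le] at *
      constructor <;> linarith [hU.1, hU.2, hV.1, hV.2]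
    rw [e1, abs_mul]
    calc |V - U| * |V + U| ≤ 5400 * (5 * 10 ^ 11) :=
          mul_le_mul hV e2 (abs_nonneg _) (by norm_num)
      _ ≤ 10 ^ 16 := by norm_num
  have q0 := hsq (x0 - x1) (10 ^ 11 * a0 - 10 ^ 11 * c0) hX (by
    rw [abs_le] at *
    constructor <;> linarith [ha0.1, ha0.2, hc0.1, hc0.2])
  have q1 := hsq (y0 - y1) (10 ^ 11 * a1 - 10 ^ 11 * c1) hY (by
    rw [abs_le] at *
    constructor <;> linarith [ha1.1, ha1.2, hc1.1, hc1.2])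
  have hs : (10 ^ 11 * a0 - 10 ^ 11 * c0) ^ 2 + (10 ^ 11 * a1 - 10 ^ 11 * c1) ^ 2
      = 10 ^ 22 * d ^ 2 := by rw [hd]; ring
  rw [abs_le] at q0 q1
  constructor
  · rintro rfl
    rcases lt_abs.1 h1 with h | h <;> linarith [q0.1, q0.2, q1.1, q1.2]
  · rw [abs_lt] at h2 ⊢
    constructor
    · have : (0.97 : ℝ) ^ 2 < d ^ 2 := by
        norm_num
        linarith [q0.1, q0.2, q1.1, q1.2, h2.1]
      have := lt_of_pow_lt_pow_left₀ 2 hd0 this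
      linarith
    · have : d ^ 2 < (1.03 : ℝ) ^ 2 := by
        norm_num
        linarith [q0.1, q0.2, q1.1, q1.2, h2.2]
      have := lt_of_pow_lt_pow_left₀ 2 (by norm_num) this
      linarith

theorem mem_take {e : Fin 59 × Fin 59} (he : e ∈ EL.take 115) : ∃ j < 115, edg j = e := by
  obtain ⟨j, hj, rfl⟩ := List.mem_iff_getElem.1 he
  have hl := EL_length
  rw [List.length_take] at hj
  have hj' : j < 115 := by omega
  refine ⟨j, hj', ?_⟩
  rw [edg, List.getD_eq_getElem _ _ (by omega), List.getElem_take]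

theorem near_matchstick_59 :
    ∃ (P : Fin 59 → EuclideanSpace ℝ (Fin 2)) (E : Finset (Fin 59 × Fin 59)),
      Function.Injective P ∧
      (∀ e ∈ E, e.1 < e.2) ∧
      E.card = 118 ∧
      (∀ v : Fin 59, (E.filter (fun e => e.1 = v ∨ e.2 = v)).card = 4) ∧
      (∀ e ∈ E, ∀ f ∈ E, e ≠ f →
        ∀ x ∈ segment ℝ (P e.1) (P e.2) ∩ segment ℝ (P f.1) (P f.2),
          (x = P e.1 ∨ x = P e.2) ∧ (x = P f.1 ∨ x = P f.2)) ∧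
      (E.filter (fun e => dist (P e.1) (P e.2) = 1)).card = 115 ∧
      (∀ e ∈ E, dist (P e.1) (P e.2) = 1 ∨ |dist (P e.1) (P e.2) - 1| < 0.03) := by
  obtain ⟨px, py, h1, h2, h3⟩ := exists_pos
  let P : Fin 59 → EuclideanSpace ℝ (Fin 2) := fun i => !₂[px i / 10 ^ 11, py i / 10 ^ 11]
  have hP : Close P := by
    intro i
    have e0 : (10 : ℝ) ^ 11 * P i 0 = px i := by
      simp only [P, Matrix.cons_val_zero]
      ring
    have e1 : (10 : ℝ) ^ 11 * P i 1 = py i := by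
      simp only [P, Matrix.cons_val_one, Matrix.cons_val_fin_one]
      ring
    rw [e0, e1]
    exact ⟨h1 i, h2 i⟩
  have hunit : ∀ e ∈ EL.take 115, dist (P e.1) (P e.2) = 1 := by
    intro e he
    obtain ⟨j, hj, rfl⟩ := mem_take he
    have := h3 j hj
    rw [EuclideanSpace.dist_eq, Fin.sum_univ_two, Real.dist_eq, Real.dist_eq, sq_abs, sq_abs,
      Real.sqrt_eq_one]
    simp only [P, Matrix.cons_val_zero, Matrix.cons_val_one,
      Matrix.cons_val_fin_one, ← sub_div, div_pow]
    rw [← add_div, this]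
    norm_num
  have hex : ∀ e ∈ EL.drop 115, dist (P e.1) (P e.2) ≠ 1 ∧ |dist (P e.1) (P e.2) - 1| < 0.03 :=
    fun e he => dist_ex hP e (chk8 e he).1 (chk8 e he).2
  have hsplit : ∀ e ∈ EL, e ∈ EL.take 115 ∨ e ∈ EL.drop 115 := by
    intro e he
    rw [← List.take_append_drop 115 EL, List.mem_append] at he
    exact he
  have hmem : ∀ e, e ∈ EL.toFinset ↔ e ∈ EL := fun e => List.mem_toFinset
  refine ⟨P, EL.toFinset, inj_sound hP, ?_, ?_, ?_, ?_, ?_, ?_⟩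
  · intro e he
    exact EL_lt e ((hmem e).1 he)
  · rw [List.toFinset_card_of_nodup EL_nodup, EL_length]
  · intro v
    have h := chk7 v
    rw [← List.toFinset_card_of_nodup (EL_nodup.filter _)] at h
    rw [← h]
    refine congrArg Finset.card ?_
    ext e
    simp only [Finset.mem_filter, List.mem_toFinset, List.mem_filter, Bool.or_eq_true,
      decide_eq_true_eq]
  · intro e he f hf hne x hx
    rw [hmem] at he hf
    have hpw : EL.Pairwise (fun e f => ∀ x, x ∈ segment ℝ (P e.1) (P e.2) →
        x ∈ segment ℝ (P f.1) (P f.2) →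
        (x = P e.1 ∨ x = P e.2) ∧ (x = P f.1 ∨ x = P f.2)) :=
      (allP_spec chk4).imp (fun h x hx hy => pair_sound hP h hx hy)
    have : Std.Symm (fun e f : Fin 59 × Fin 59 => ∀ x, x ∈ segment ℝ (P e.1) (P e.2) →
        x ∈ segment ℝ (P f.1) (P f.2) →
        (x = P e.1 ∨ x = P e.2) ∧ (x = P f.1 ∨ x = P f.2)) :=
      ⟨fun e f h x hx hy => (h x hy hx).symm⟩
    exact hpw.forall he hf hne x hx.1 hx.2
  · have h : (EL.take 115).toFinset.card = 115 := by
      rw [List.toFinset_card_of_nodup (EL_nodup.sublist (List.take_sublist _ _)),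
        List.length_take, EL_length]
      rfl
    rw [← h]
    refine congrArg Finset.card ?_
    ext e
    simp only [Finset.mem_filter, List.mem_toFinset]
    constructor
    · rintro ⟨he, hd⟩
      rcases hsplit e he with h | h
      · exact h
      · exact absurd hd (hex e h).1
    · intro he
      exact ⟨List.mem_of_mem_take he, hunit e he⟩
  · intro e he
    rcases hsplit e ((hmem e).1 he) with h | h
    · exact Or.inl (hunit e h)
    · exact Or.inr (hex e h).2
end

section
/- There exist 60 distinct points in ℝ² and a set E of 120 unordered pairs of these points such that every point is an endpoint of exactly 4 pairs in E, the closed segments of any two distinct pairs intersect at most in a common endpoint, exactly 118 of the pairs join points at distance exactly 1, and the remaining 2 pairs join points at one common distance t with |t − 1| < 0.099. -/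
structure NmRec where
  u : Fin 60
  v : Fin 60
  ax : ℤ
  ay : ℤ
  bx : ℤ
  bz : ℤ

def nmKt : Fin 22 → ℤ × ℤ × ℤ × ℤ := ![
  (81, 21, -93, 59), (114, -12, -48, 34), (132, 0, -132, 88), (30, 42, -54, 30), (165, -33, -87, 63),
  (132, 0, -84, 32), (36, 24, -120, 52), (198, -66, -42, 38), (0, 0, 0, 0), (117, -21, -81, 45),
  (99, -33, -21, 19), (18, 12, -60, 26), (183, -21, -93, 59), (150, 12, -48, 34), (234, -42, -54, 30),
  (99, 33, -87, 63), (228, -24, -120, 52), (66, 66, -42, 38), (264, 0, 0, 0), (147, 21, -81, 45),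
  (165, 33, -21, 19), (246, -12, -60, 26)]

def nmLE : List (Fin 11 × Fin 11) := [(0, 1), (0, 3), (1, 2), (1, 9), (1, 3), (2, 7), (2, 10), (2, 9), (3, 6), (3, 5), (4, 8), (4, 6), (5, 8), (5, 7), (5, 6), (6, 8), (7, 8), (7, 10)]

def nmKE : List (Fin 22 × Fin 22) := [
  (0, 4), (0, 1), (0, 3), (0, 2), (1, 7), (1, 3), (1, 4), (2, 4), (3, 5), (3, 6),
  (4, 7), (5, 6), (6, 11), (6, 9), (7, 9), (7, 10), (8, 10), (8, 11), (9, 10), (9, 11),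
  (10, 11), (12, 15), (12, 13), (12, 14), (12, 2), (13, 17), (13, 14), (13, 15), (2, 15), (14, 5),
  (14, 16), (15, 17), (5, 16), (16, 21), (16, 19), (17, 19), (17, 20), (18, 20), (18, 21), (19, 20),
  (19, 21), (20, 21)]

def nmLab : Fin 32 → Fin 11 ⊕ Fin 22 := ![ 
  .inl 0, .inl 9, .inl 10, .inr 18, .inl 1, .inl 2, .inl 3, .inl 4,
  .inl 5, .inl 6, .inl 7, .inl 8, .inr 0, .inr 1, .inr 2, .inr 3,
  .inr 4, .inr 5, .inr 6, .inr 7, .inr 9, .inr 10, .inr 11, .inr 12,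
  .inr 13, .inr 14, .inr 15, .inr 16, .inr 17, .inr 19, .inr 20, .inr 21]

def nmA : Fin 32 → ℤ × ℤ := ![
  (30958394280, 0), (26399989176, 0), (-26399989176, 0), (149899542408, 0),
  (13220779176, 22875061176), (0, 23999976), (39537760416, 24967067664), (11346759864, 69611300088),
  (13158490752, 23921064552), (25442260272, 47289184008), (-13220779176, 22875061176), (-937009656, 46243180632),
  (96280168563, 71257811331), (69893717922, 72103519806), (110205798912, 93686293668), (82354538214, 48829328994),
  (83819348271, 94532002143), (74939071896, 23492185140), (56704194828, 42582739284), (57432897630, 95377710618),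
  (57068546229, 68980224951), (34389828747, 82494505353), (34025477346, 56097019686), (100523423619, 69125927061),
  (116952137370, 48460560786), (90841048326, 44565560454), (126634512663, 73020927393), (101140138476, 20257357236),
  (143063226414, 52355561118), (122101682445, 36306459177), (146481384411, 26177780559), (125519840442, 10128678618)]

def nmvL (s : Bool) : Fin 11 → Fin 60 :=
  if s then ![0, 4, 5, 6, 7, 8, 9, 10, 11, 1, 2]
  else ![0, 32, 33, 34, 35, 36, 37, 38, 39, 1, 2]

def nmvK (s : Bool) : Fin 22 → Fin 60 :=
  if s then ![12, 13, 14, 15, 16, 17, 18, 19, 7, 20, 21, 22, 23, 24, 25, 26, 27, 28, 3, 29, 30, 31]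
  else ![40, 41, 42, 43, 44, 45, 46, 47, 35, 48, 49, 50, 51, 52, 53, 54, 55, 56, 3, 57, 58, 59]

def nmEC : List NmRec := [
  ⟨0, 4, 30958394280, 0, 13220779176, 22875061176⟩, ⟨0, 6, 30958394280, 0, 39537760416, 24967067664⟩,
  ⟨4, 5, 13220779176, 22875061176, 0, 23999976⟩, ⟨1, 4, 26399989176, 0, 13220779176, 22875061176⟩,
  ⟨4, 6, 13220779176, 22875061176, 39537760416, 24967067664⟩, ⟨5, 10, 0, 23999976, -13220779176, 22875061176⟩,
  ⟨2, 5, -26399989176, 0, 0, 23999976⟩, ⟨1, 5, 26399989176, 0, 0, 23999976⟩,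
  ⟨6, 9, 39537760416, 24967067664, 25442260272, 47289184008⟩, ⟨6, 8, 39537760416, 24967067664, 13158490752, 23921064552⟩,
  ⟨7, 11, 11346759864, 69611300088, -937009656, 46243180632⟩, ⟨7, 9, 11346759864, 69611300088, 25442260272, 47289184008⟩,
  ⟨8, 11, 13158490752, 23921064552, -937009656, 46243180632⟩, ⟨8, 10, 13158490752, 23921064552, -13220779176, 22875061176⟩,
  ⟨8, 9, 13158490752, 23921064552, 25442260272, 47289184008⟩, ⟨9, 11, 25442260272, 47289184008, -937009656, 46243180632⟩,
  ⟨10, 11, -13220779176, 22875061176, -937009656, 46243180632⟩, ⟨2, 10, -26399989176, 0, -13220779176, 22875061176⟩,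
  ⟨12, 16, 96280168563, 71257811331, 83819348271, 94532002143⟩, ⟨12, 13, 96280168563, 71257811331, 69893717922, 72103519806⟩,
  ⟨12, 15, 96280168563, 71257811331, 82354538214, 48829328994⟩, ⟨12, 14, 96280168563, 71257811331, 110205798912, 93686293668⟩,
  ⟨13, 19, 69893717922, 72103519806, 57432897630, 95377710618⟩, ⟨13, 15, 69893717922, 72103519806, 82354538214, 48829328994⟩,
  ⟨13, 16, 69893717922, 72103519806, 83819348271, 94532002143⟩, ⟨14, 16, 110205798912, 93686293668, 83819348271, 94532002143⟩,
  ⟨15, 17, 82354538214, 48829328994, 74939071896, 23492185140⟩, ⟨15, 18, 82354538214, 48829328994, 56704194828, 42582739284⟩,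
  ⟨16, 19, 83819348271, 94532002143, 57432897630, 95377710618⟩, ⟨17, 18, 74939071896, 23492185140, 56704194828, 42582739284⟩,
  ⟨18, 22, 56704194828, 42582739284, 34025477346, 56097019686⟩, ⟨18, 20, 56704194828, 42582739284, 57068546229, 68980224951⟩,
  ⟨19, 20, 57432897630, 95377710618, 57068546229, 68980224951⟩, ⟨19, 21, 57432897630, 95377710618, 34389828747, 82494505353⟩,
  ⟨7, 21, 11346759864, 69611300088, 34389828747, 82494505353⟩, ⟨7, 22, 11346759864, 69611300088, 34025477346, 56097019686⟩,
  ⟨20, 21, 57068546229, 68980224951, 34389828747, 82494505353⟩, ⟨20, 22, 57068546229, 68980224951, 34025477346, 56097019686⟩,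
  ⟨21, 22, 34389828747, 82494505353, 34025477346, 56097019686⟩, ⟨23, 26, 100523423619, 69125927061, 126634512663, 73020927393⟩,
  ⟨23, 24, 100523423619, 69125927061, 116952137370, 48460560786⟩, ⟨23, 25, 100523423619, 69125927061, 90841048326, 44565560454⟩,
  ⟨14, 23, 110205798912, 93686293668, 100523423619, 69125927061⟩, ⟨24, 28, 116952137370, 48460560786, 143063226414, 52355561118⟩,
  ⟨24, 25, 116952137370, 48460560786, 90841048326, 44565560454⟩, ⟨24, 26, 116952137370, 48460560786, 126634512663, 73020927393⟩,
  ⟨14, 26, 110205798912, 93686293668, 126634512663, 73020927393⟩, ⟨17, 25, 74939071896, 23492185140, 90841048326, 44565560454⟩,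
  ⟨25, 27, 90841048326, 44565560454, 101140138476, 20257357236⟩, ⟨26, 28, 126634512663, 73020927393, 143063226414, 52355561118⟩,
  ⟨17, 27, 74939071896, 23492185140, 101140138476, 20257357236⟩, ⟨27, 31, 101140138476, 20257357236, 125519840442, 10128678618⟩,
  ⟨27, 29, 101140138476, 20257357236, 122101682445, 36306459177⟩, ⟨28, 29, 143063226414, 52355561118, 122101682445, 36306459177⟩,
  ⟨28, 30, 143063226414, 52355561118, 146481384411, 26177780559⟩, ⟨3, 30, 149899542408, 0, 146481384411, 26177780559⟩,
  ⟨3, 31, 149899542408, 0, 125519840442, 10128678618⟩, ⟨29, 30, 122101682445, 36306459177, 146481384411, 26177780559⟩,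
  ⟨29, 31, 122101682445, 36306459177, 125519840442, 10128678618⟩, ⟨30, 31, 146481384411, 26177780559, 125519840442, 10128678618⟩,
  ⟨0, 32, 30958394280, 0, 13220779176, -22875061176⟩, ⟨0, 34, 30958394280, 0, 39537760416, -24967067664⟩,
  ⟨32, 33, 13220779176, -22875061176, 0, -23999976⟩, ⟨1, 32, 26399989176, 0, 13220779176, -22875061176⟩,
  ⟨32, 34, 13220779176, -22875061176, 39537760416, -24967067664⟩, ⟨33, 38, 0, -23999976, -13220779176, -22875061176⟩,
  ⟨2, 33, -26399989176, 0, 0, -23999976⟩, ⟨1, 33, 26399989176, 0, 0, -23999976⟩,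
  ⟨34, 37, 39537760416, -24967067664, 25442260272, -47289184008⟩, ⟨34, 36, 39537760416, -24967067664, 13158490752, -23921064552⟩,
  ⟨35, 39, 11346759864, -69611300088, -937009656, -46243180632⟩, ⟨35, 37, 11346759864, -69611300088, 25442260272, -47289184008⟩,
  ⟨36, 39, 13158490752, -23921064552, -937009656, -46243180632⟩, ⟨36, 38, 13158490752, -23921064552, -13220779176, -22875061176⟩,
  ⟨36, 37, 13158490752, -23921064552, 25442260272, -47289184008⟩, ⟨37, 39, 25442260272, -47289184008, -937009656, -46243180632⟩,
  ⟨38, 39, -13220779176, -22875061176, -937009656, -46243180632⟩, ⟨2, 38, -26399989176, 0, -13220779176, -22875061176⟩,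
  ⟨40, 44, 96280168563, -71257811331, 83819348271, -94532002143⟩, ⟨40, 41, 96280168563, -71257811331, 69893717922, -72103519806⟩,
  ⟨40, 43, 96280168563, -71257811331, 82354538214, -48829328994⟩, ⟨40, 42, 96280168563, -71257811331, 110205798912, -93686293668⟩,
  ⟨41, 47, 69893717922, -72103519806, 57432897630, -95377710618⟩, ⟨41, 43, 69893717922, -72103519806, 82354538214, -48829328994⟩,
  ⟨41, 44, 69893717922, -72103519806, 83819348271, -94532002143⟩, ⟨42, 44, 110205798912, -93686293668, 83819348271, -94532002143⟩,
  ⟨43, 45, 82354538214, -48829328994, 74939071896, -23492185140⟩, ⟨43, 46, 82354538214, -48829328994, 56704194828, -42582739284⟩,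
  ⟨44, 47, 83819348271, -94532002143, 57432897630, -95377710618⟩, ⟨45, 46, 74939071896, -23492185140, 56704194828, -42582739284⟩,
  ⟨46, 50, 56704194828, -42582739284, 34025477346, -56097019686⟩, ⟨46, 48, 56704194828, -42582739284, 57068546229, -68980224951⟩,
  ⟨47, 48, 57432897630, -95377710618, 57068546229, -68980224951⟩, ⟨47, 49, 57432897630, -95377710618, 34389828747, -82494505353⟩,
  ⟨35, 49, 11346759864, -69611300088, 34389828747, -82494505353⟩, ⟨35, 50, 11346759864, -69611300088, 34025477346, -56097019686⟩,
  ⟨48, 49, 57068546229, -68980224951, 34389828747, -82494505353⟩, ⟨48, 50, 57068546229, -68980224951, 34025477346, -56097019686⟩,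
  ⟨49, 50, 34389828747, -82494505353, 34025477346, -56097019686⟩, ⟨51, 54, 100523423619, -69125927061, 126634512663, -73020927393⟩,
  ⟨51, 52, 100523423619, -69125927061, 116952137370, -48460560786⟩, ⟨51, 53, 100523423619, -69125927061, 90841048326, -44565560454⟩,
  ⟨42, 51, 110205798912, -93686293668, 100523423619, -69125927061⟩, ⟨52, 56, 116952137370, -48460560786, 143063226414, -52355561118⟩,
  ⟨52, 53, 116952137370, -48460560786, 90841048326, -44565560454⟩, ⟨52, 54, 116952137370, -48460560786, 126634512663, -73020927393⟩,
  ⟨42, 54, 110205798912, -93686293668, 126634512663, -73020927393⟩, ⟨45, 53, 74939071896, -23492185140, 90841048326, -44565560454⟩,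
  ⟨53, 55, 90841048326, -44565560454, 101140138476, -20257357236⟩, ⟨54, 56, 126634512663, -73020927393, 143063226414, -52355561118⟩,
  ⟨45, 55, 74939071896, -23492185140, 101140138476, -20257357236⟩, ⟨55, 59, 101140138476, -20257357236, 125519840442, -10128678618⟩,
  ⟨55, 57, 101140138476, -20257357236, 122101682445, -36306459177⟩, ⟨56, 57, 143063226414, -52355561118, 122101682445, -36306459177⟩,
  ⟨56, 58, 143063226414, -52355561118, 146481384411, -26177780559⟩, ⟨3, 58, 149899542408, 0, 146481384411, -26177780559⟩,
  ⟨3, 59, 149899542408, 0, 125519840442, -10128678618⟩, ⟨57, 58, 122101682445, -36306459177, 146481384411, -26177780559⟩,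
  ⟨57, 59, 122101682445, -36306459177, 125519840442, -10128678618⟩, ⟨58, 59, 146481384411, -26177780559, 125519840442, -10128678618⟩]
noncomputable section NmReal

def nmr : ℝ := √3
def nms : ℝ := √5
def nmd : ℝ := 4400 / 4840001
def nmc : ℝ := 4839999 / 4840001
def nmw : ℝ := nmc + nmd * nmr
def nmx : ℝ := (nmw ^ 2 + 3) / (2 * nmw)
def nmh : ℝ := √(4 - nmx ^ 2)
def nmb : ℝ := (nmc * nmr + nmd) / 2
def nmg0 : ℝ := √(1 - (nmb + nmh) ^ 2)
def nmTx : ℝ := -nmw / 2 + nmx / 2 - nmr * nmh / 2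
def nmTy : ℝ := nmb + nmr * nmx / 2 + nmh / 2
def nmg : ℝ := √((687 + 279 * nms) / 38 - nmTy ^ 2)

theorem nm_sqrt_bd (a l u : ℝ) (hu : 0 ≤ u) (h1 : l ^ 2 ≤ a) (h2 : a ≤ u ^ 2) :
    l ≤ √a ∧ √a ≤ u :=
  ⟨Real.le_sqrt_of_sq_le h1, (Real.sqrt_le_left hu).2 h2⟩

theorem nm_mul_bd {a b l u l' u' : ℝ} (h : l ≤ a ∧ a ≤ u) (h' : l' ≤ b ∧ b ≤ u') (hl : 0 ≤ l)
    (hl' : 0 ≤ l') : l * l' ≤ a * b ∧ a * b ≤ u * u' :=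
  ⟨mul_le_mul h.1 h'.1 hl' (hl.trans h.1),
   mul_le_mul h.2 h'.2 (hl'.trans h'.1) (hl.trans (h.1.trans h.2))⟩

theorem nmr_bd : (1.7320508075688772 : ℝ) ≤ nmr ∧ nmr ≤ 1.7320508075688773 :=
  nm_sqrt_bd _ _ _ (by norm_num) (by norm_num) (by norm_num)

theorem nms_bd : (2.2360679774997896 : ℝ) ≤ nms ∧ nms ≤ 2.2360679774997898 :=
  nm_sqrt_bd _ _ _ (by norm_num) (by norm_num) (by norm_num)

theorem nmr_sq : nmr ^ 2 = 3 := Real.sq_sqrt (by norm_num)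
theorem nms_sq : nms ^ 2 = 5 := Real.sq_sqrt (by norm_num)

theorem nmw_bd : (1.00157417809486 : ℝ) ≤ nmw ∧ nmw ≤ 1.00157417809487 := by
  have := nmr_bd
  unfold nmw nmc nmd
  constructor <;> linarith

theorem nmb_bd : (0.86647959128340 : ℝ) ≤ nmb ∧ nmb ≤ 0.86647959128341 := by
  have := nmr_bd
  unfold nmb nmc nmd
  constructor <;> linarith

theorem nmwx : 2 * nmw * nmx = nmw ^ 2 + 3 := by
  have := nmw_bd
  have : nmw ≠ 0 := by linarith
  unfold nmx
  field_simp

theorem nmx_bd : (1.99842953311802 : ℝ) ≤ nmx ∧ nmx ≤ 1.99842953311806 := by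
  have hw := nmw_bd
  have hp : 0 < 2 * nmw := by linarith
  unfold nmx
  rw [le_div_iff₀ hp, div_le_iff₀ hp]
  constructor <;> nlinarith

theorem nmh_arg : (0.0792426726 : ℝ) ^ 2 ≤ 4 - nmx ^ 2 ∧ 4 - nmx ^ 2 ≤ (0.0792426727 : ℝ) ^ 2 := by
  have hx := nmx_bd
  constructor <;> nlinarith

theorem nmh_bd : (0.0792426726 : ℝ) ≤ nmh ∧ nmh ≤ 0.0792426727 :=
  nm_sqrt_bd _ _ _ (by norm_num) nmh_arg.1 nmh_arg.2

theorem nmh_sq : nmx ^ 2 + nmh ^ 2 = 4 := by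
  have : nmh ^ 2 = 4 - nmx ^ 2 := Real.sq_sqrt (by have := nmh_arg; nlinarith)
  linarith

theorem nmg0_arg : (0.324975998 : ℝ) ^ 2 ≤ 1 - (nmb + nmh) ^ 2 ∧
    1 - (nmb + nmh) ^ 2 ≤ (0.324975999 : ℝ) ^ 2 := by
  have hb := nmb_bd
  have hx := nmh_bd
  constructor <;> nlinarith

theorem nmg0_bd : (0.324975998 : ℝ) ≤ nmg0 ∧ nmg0 ≤ 0.324975999 :=
  nm_sqrt_bd _ _ _ (by norm_num) nmg0_arg.1 nmg0_arg.2

theorem nmg0_sq : nmg0 ^ 2 + (nmb + nmh) ^ 2 = 1 := by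
  have : nmg0 ^ 2 = 1 - (nmb + nmh) ^ 2 := Real.sq_sqrt (by have := nmg0_arg; nlinarith)
  linarith

theorem nmrx_bd : (3.4613814867 : ℝ) ≤ nmr * nmx ∧ nmr * nmx ≤ 3.4613814868 := by
  have := nm_mul_bd nmr_bd nmx_bd (by norm_num) (by norm_num)
  constructor <;> linarith

theorem nmrh_bd : (0.137252334 : ℝ) ≤ nmr * nmh ∧ nmr * nmh ≤ 0.1372523353 := by
  have := nm_mul_bd nmr_bd nmh_bd (by norm_num) (by norm_num)
  constructor <;> linarith

theorem nmTx_bd : (0.4298015098 : ℝ) ≤ nmTx ∧ nmTx ≤ 0.429801511 := by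
  have h1 := nmw_bd
  have h2 := nmx_bd
  have h3 := nmrh_bd
  unfold nmTx
  constructor <;> linarith

theorem nmTy_bd : (2.6367916708 : ℝ) ≤ nmTy ∧ nmTy ≤ 2.6367916711 := by
  have h1 := nmb_bd
  have h2 := nmrx_bd
  have h3 := nmh_bd
  unfold nmTy
  constructor <;> linarith

theorem nmg_arg : (5.2482114589 : ℝ) ^ 2 ≤ (687 + 279 * nms) / 38 - nmTy ^ 2 ∧
    (687 + 279 * nms) / 38 - nmTy ^ 2 ≤ (5.2482114592 : ℝ) ^ 2 := by
  have hb := nms_bd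
  have hx := nmTy_bd
  constructor <;> nlinarith

theorem nmg_bd : (5.2482114589 : ℝ) ≤ nmg ∧ nmg ≤ 5.2482114592 :=
  nm_sqrt_bd _ _ _ (by norm_num) nmg_arg.1 nmg_arg.2

theorem nmg_sq : 38 * (nmg ^ 2 + nmTy ^ 2) = 687 + 279 * nms := by
  have : nmg ^ 2 = (687 + 279 * nms) / 38 - nmTy ^ 2 :=
    Real.sq_sqrt (by have := nmg_arg; nlinarith)
  linarith

theorem nmsg_bd : (11.735357582 : ℝ) ≤ nms * nmg ∧ nms * nmg ≤ 11.735357584 := by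
  have := nm_mul_bd nms_bd nmg_bd (by norm_num) (by norm_num)
  constructor <;> linarith

theorem nmsT_bd : (5.896045418 : ℝ) ≤ nms * nmTy ∧ nms * nmTy ≤ 5.89604542 := by
  have := nm_mul_bd nms_bd nmTy_bd (by norm_num) (by norm_num)
  constructor <;> linarith

theorem nmrT_bd : (4.567057142 : ℝ) ≤ nmr * nmTy ∧ nmr * nmTy ≤ 4.567057144 := by
  have := nm_mul_bd nmr_bd nmTy_bd (by norm_num) (by norm_num)
  constructor <;> linarith

theorem nmrg_bd : (9.090168895 : ℝ) ≤ nmr * nmg ∧ nmr * nmg ≤ 9.090168897 := by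
  have := nm_mul_bd nmr_bd nmg_bd (by norm_num) (by norm_num)
  constructor <;> linarith

theorem nmrsT_bd : (10.212250227 : ℝ) ≤ nmr * (nms * nmTy) ∧ nmr * (nms * nmTy) ≤ 10.212250233 := by
  have := nm_mul_bd nmr_bd nmsT_bd (by norm_num) (by norm_num)
  constructor <;> linarith

theorem nmrsg_bd : (20.326235576 : ℝ) ≤ nmr * (nms * nmg) ∧ nmr * (nms * nmg) ≤ 20.326235582 := by
  have := nm_mul_bd nmr_bd nmsg_bd (by norm_num) (by norm_num)
  constructor <;> linarith

def nmXL : Fin 11 → ℝ := ![nmx - nmw / 2 - nmg0, nmw / 2, 0, nmx - nmw / 2, nmTx,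
  -nmw / 2 + nmx / 2, -nmw / 2 + nmx / 2 + nmx / 4 - nmr * nmh / 4, -nmw / 2,
  -nmw / 2 + nmx / 4 - nmr * nmh / 4, nmc, -nmc]

def nmYL : Fin 11 → ℝ := ![0, nmb, nmd, nmb + nmh, nmTy, nmb + nmh / 2,
  nmb + nmh / 2 + nmr * nmx / 4 + nmh / 4, nmb, nmb + nmr * nmx / 4 + nmh / 4, 0, 0]

def nmXK (j : Fin 22) : ℝ :=
  nmTx + ((nmKt j).1 * nmg + (nmKt j).2.1 * (nms * nmg) + (nmKt j).2.2.1 * (nmr * nmTy)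
    + (nmKt j).2.2.2 * (nmr * (nms * nmTy))) / 264

def nmYK (j : Fin 22) : ℝ :=
  nmTy + (-(nmKt j).1 * nmTy - (nmKt j).2.1 * (nms * nmTy) + (nmKt j).2.2.1 * (nmr * nmg)
    + (nmKt j).2.2.2 * (nmr * (nms * nmg))) / 264

/-- Unit edges of the linker part (every edge of the list except the first). -/
theorem nm_unit_L : ∀ e ∈ nmLE, e ≠ (0, 1) →
    (nmXL e.1 - nmXL e.2) ^ 2 + (nmYL e.1 - nmYL e.2) ^ 2 = 1 := by
  have h1 := nmr_sq
  have h2 := nmh_sq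
  have h3 := nmg0_sq
  have h4 := nmwx
  have h5 : nmc ^ 2 + nmd ^ 2 = 1 := by unfold nmc nmd; norm_num
  have hw : nmw = nmc + nmd * nmr := rfl
  have hb : nmb = (nmc * nmr + nmd) / 2 := rfl
  have hTx : nmTx = -nmw / 2 + nmx / 2 - nmr * nmh / 2 := rfl
  have hTy : nmTy = nmb + nmr * nmx / 2 + nmh / 2 := rfl
  simp only [nmLE, List.forall_mem_cons, List.not_mem_nil, false_imp_iff, implies_true, and_true]
  refine ⟨by simp, ?_⟩
  simp [nmXL, nmYL]
  repeat' apply And.intro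
  all_goals
    first
      | linear_combination h3
      | linear_combination h5
      | linear_combination h2 - h4
      | linear_combination h2 / 4
      | linear_combination (1 + nmr ^ 2) / 16 * h2 + 1 / 4 * h1
      | (rw [hTx, hTy]; linear_combination (1 + nmr ^ 2) / 16 * h2 + 1 / 4 * h1)
      | (simp only [hw, hb]; linear_combination (1 + nmr ^ 2) / 4 * h5 + 1 / 4 * h1)

theorem nm_unit_K_aux : ∀ e ∈ nmKE,
    (fun a b c d : ℤ => 687 * (a ^ 2 + 5 * b ^ 2 + 3 * (c ^ 2 + 5 * d ^ 2))
        + 1395 * (2 * a * b + 6 * c * d) = 38 * 264 ^ 2 ∧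
      279 * (a ^ 2 + 5 * b ^ 2 + 3 * (c ^ 2 + 5 * d ^ 2)) + 687 * (2 * a * b + 6 * c * d) = 0)
      ((nmKt e.1).1 - (nmKt e.2).1) ((nmKt e.1).2.1 - (nmKt e.2).2.1)
      ((nmKt e.1).2.2.1 - (nmKt e.2).2.2.1) ((nmKt e.1).2.2.2 - (nmKt e.2).2.2.2) := by
  decide +kernel

theorem nm_unit_K (e) (he : e ∈ nmKE) :
    (nmXK e.1 - nmXK e.2) ^ 2 + (nmYK e.1 - nmYK e.2) ^ 2 = 1 := by
  have h1 := nmr_sq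
  have h2 := nms_sq
  have h3 := nmg_sq
  obtain ⟨k1, k2⟩ := nm_unit_K_aux e he
  unfold nmXK nmYK
  have k1' := congrArg (Int.cast (R := ℝ)) k1
  have k2' := congrArg (Int.cast (R := ℝ)) k2
  push_cast at k1' k2'
  generalize ((nmKt e.1).1 : ℝ) = a1 at *
  generalize ((nmKt e.2).1 : ℝ) = a2 at *
  generalize ((nmKt e.1).2.1 : ℝ) = b1 at *
  generalize ((nmKt e.2).2.1 : ℝ) = b2 at *
  generalize ((nmKt e.1).2.2.1 : ℝ) = c1 at *
  generalize ((nmKt e.2).2.2.1 : ℝ) = c2 at *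
  generalize ((nmKt e.1).2.2.2 : ℝ) = d1 at *
  generalize ((nmKt e.2).2.2.2 : ℝ) = d2 at *
  have e1 : a1 - a2 = a1 - a2 := rfl
  generalize hA : a1 - a2 = A at *
  generalize hB : b1 - b2 = B at *
  generalize hC : c1 - c2 = C at *
  generalize hD : d1 - d2 = D at *
  obtain rfl : a1 = a2 + A := by linarith
  obtain rfl : b1 = b2 + B := by linarith
  obtain rfl : c1 = c2 + C := by linarith
  obtain rfl : d1 = d2 + D := by linarith
  have key : 38 * 264 ^ 2 * ((nmTx + ((a2 + A) * nmg + (b2 + B) * (nms * nmg) + (c2 + C) * (nmr * nmTy)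
    + (d2 + D) * (nmr * (nms * nmTy))) / 264 - (nmTx + (a2 * nmg + b2 * (nms * nmg) + c2 * (nmr * nmTy)
    + d2 * (nmr * (nms * nmTy))) / 264)) ^ 2 + (nmTy + (-(a2 + A) * nmTy - (b2 + B) * (nms * nmTy) + (c2 + C) * (nmr * nmg)
    + (d2 + D) * (nmr * (nms * nmg))) / 264 - (nmTy + (-a2 * nmTy - b2 * (nms * nmTy) + c2 * (nmr * nmg)
    + d2 * (nmr * (nms * nmg))) / 264)) ^ 2)
     = 38 * (nmg ^ 2 + nmTy ^ 2) * ((A + B * nms) ^ 2 + nmr ^ 2 * (C + D * nms) ^ 2) := by ring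
  rw [h3, h1] at key
  have key2 : (687 + 279 * nms) * ((A + B * nms) ^ 2 + 3 * (C + D * nms) ^ 2) = 38 * 264 ^ 2 := by
    linear_combination k1' + nms * k2' + (687 * (B ^ 2 + 3 * D ^ 2)
      + 279 * (2 * A * B + 6 * C * D) + 279 * nms * (B ^ 2 + 3 * D ^ 2)) * h2
  linarith

theorem nm_ap_L (i : Fin 11) (v : Fin 32) (h : nmLab v = .inl i) :
    |nmXL i * 26400000000 - (nmA v).1| ≤ 3000 ∧ |nmYL i * 26400000000 - (nmA v).2| ≤ 3000 := by
  have h1 := nmw_bd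
  have h2 := nmx_bd
  have h3 := nmh_bd
  have h4 := nmb_bd
  have h5 := nmg0_bd
  have h6 := nmTx_bd
  have h7 := nmTy_bd
  have h8 := nmrx_bd
  have h9 := nmrh_bd
  fin_cases v <;> simp [nmLab] at h <;> subst h <;> simp [nmXL, nmYL, nmA, nmc, nmd] <;>
    (try norm_num) <;> (try simp only [abs_le]) <;> (try (repeat' constructor)) <;> linarith

def nmAK (j : Fin 22) : ℤ × ℤ :=
  (264 * 42980151 + (nmKt j).1 * 524821146 + (nmKt j).2.1 * 1173535758
    + (nmKt j).2.2.1 * 456705714 + (nmKt j).2.2.2 * 1021225023,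
   264 * 263679167 - (nmKt j).1 * 263679167 - (nmKt j).2.1 * 589604542
    + (nmKt j).2.2.1 * 909016890 + (nmKt j).2.2.2 * 2032623558)

theorem nm_ap_K_aux : ∀ j, |(nmKt j).1| ≤ 300 ∧ |(nmKt j).2.1| ≤ 300 ∧ |(nmKt j).2.2.1| ≤ 300 ∧
    |(nmKt j).2.2.2| ≤ 300 := by decide +kernel

theorem nm_lin {a m M : ℝ} (ha : |a| ≤ 300) (hm : |m * 100000000 - M| ≤ 1) :
    |a * m * 100000000 - a * M| ≤ 300 := by
  have : a * m * 100000000 - a * M = a * (m * 100000000 - M) := by ring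
  rw [this, abs_mul]
  nlinarith [abs_nonneg a, abs_nonneg (m * 100000000 - M)]

theorem nm_ap_K (j : Fin 22) :
    |nmXK j * 26400000000 - (nmAK j).1| ≤ 3000 ∧ |nmYK j * 26400000000 - (nmAK j).2| ≤ 3000 := by
  obtain ⟨p1, p2, p3, p4⟩ := nm_ap_K_aux j
  have q1 : |((nmKt j).1 : ℝ)| ≤ 300 := by exact_mod_cast p1
  have q2 : |((nmKt j).2.1 : ℝ)| ≤ 300 := by exact_mod_cast p2
  have q3 : |((nmKt j).2.2.1 : ℝ)| ≤ 300 := by exact_mod_cast p3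
  have q4 : |((nmKt j).2.2.2 : ℝ)| ≤ 300 := by exact_mod_cast p4
  have bd : ∀ {m l u : ℝ} (M : ℝ), l ≤ m ∧ m ≤ u → M - 1 ≤ l * 100000000 → u * 100000000 ≤ M + 1 →
      |m * 100000000 - M| ≤ 1 := by
    intro m l u M h h1 h2
    rw [abs_le]
    constructor <;> linarith [h.1, h.2]
  have t1 := bd 42980151 nmTx_bd (by norm_num) (by norm_num)
  have t2 := bd 263679167 nmTy_bd (by norm_num) (by norm_num)
  have u1 := nm_lin q1 (bd 524821146 nmg_bd (by norm_num) (by norm_num))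
  have u2 := nm_lin q2 (bd 1173535758 nmsg_bd (by norm_num) (by norm_num))
  have u3 := nm_lin q3 (bd 456705714 nmrT_bd (by norm_num) (by norm_num))
  have u4 := nm_lin q4 (bd 1021225023 nmrsT_bd (by norm_num) (by norm_num))
  have v1 := nm_lin q1 t2
  have v2 := nm_lin q2 (bd 589604542 nmsT_bd (by norm_num) (by norm_num))
  have v3 := nm_lin q3 (bd 909016890 nmrg_bd (by norm_num) (by norm_num))
  have v4 := nm_lin q4 (bd 2032623558 nmrsg_bd (by norm_num) (by norm_num))
  unfold nmXK nmYK nmAK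
  push_cast
  simp only [abs_le] at *
  constructor
  · constructor <;> linarith [t1.1, t1.2, u1.1, u1.2, u2.1, u2.2, u3.1, u3.2, u4.1, u4.2]
  · constructor <;> linarith [t2.1, t2.2, v1.1, v1.2, v2.1, v2.2, v3.1, v3.2, v4.1, v4.2]

end NmReal
def nmH (v : Fin 60) : Fin 32 :=
  if h : v.1 < 32 then ⟨v.1, h⟩ else ⟨v.1 - 28, by omega⟩

def nmSg (v : Fin 60) : ℤ := if v.1 < 32 then 1 else -1

noncomputable def nmX (v : Fin 60) : ℝ := Sum.elim nmXL nmXK (nmLab (nmH v))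
noncomputable def nmY (v : Fin 60) : ℝ := nmSg v * Sum.elim nmYL nmYK (nmLab (nmH v))

def nmAX (v : Fin 60) : ℤ := (nmA (nmH v)).1
def nmAY (v : Fin 60) : ℤ := nmSg v * (nmA (nmH v)).2

theorem nm_A_K : ∀ (v : Fin 32), ∀ j, nmLab v = .inr j → nmA v = nmAK j := by decide +kernel

theorem nm_half (v : Fin 32) :
    |Sum.elim nmXL nmXK (nmLab v) * 26400000000 - (nmA v).1| ≤ 3000 ∧
    |Sum.elim nmYL nmYK (nmLab v) * 26400000000 - (nmA v).2| ≤ 3000 := by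
  rcases h : nmLab v with i | j
  · exact nm_ap_L i v h
  · rw [nm_A_K v j h]
    exact nm_ap_K j

theorem nm_apX (v : Fin 60) : |nmX v * 26400000000 - nmAX v| ≤ 3000 := (nm_half _).1

theorem nm_apY (v : Fin 60) : |nmY v * 26400000000 - nmAY v| ≤ 3000 := by
  have h := (nm_half (nmH v)).2
  have : nmY v * 26400000000 - nmAY v
      = nmSg v * (Sum.elim nmYL nmYK (nmLab (nmH v)) * 26400000000 - (nmA (nmH v)).2) := by
    unfold nmY nmAY
    push_cast
    ring
  rw [this, abs_mul]
  have hs : |(nmSg v : ℝ)| = 1 := by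
    unfold nmSg
    split_ifs <;> simp
  rw [hs, one_mul]
  exact h

noncomputable def nmP (v : Fin 60) : EuclideanSpace ℝ (Fin 2) := !₂[nmX v, nmY v]

theorem nm_dist (u v : Fin 60) :
    dist (nmP u) (nmP v) = √((nmX u - nmX v) ^ 2 + (nmY u - nmY v) ^ 2) := by
  simp [nmP, EuclideanSpace.dist_eq, Fin.sum_univ_two, Real.dist_eq, sq_abs]

/-- sign attached to a half -/
def nmbs (s : Bool) : ℤ := if s then 1 else -1

theorem nm_vL_X (s : Bool) (i : Fin 11) : nmX (nmvL s i) = nmXL i := by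
  cases s <;> fin_cases i <;> rfl

theorem nm_vL_Y (s : Bool) (i : Fin 11) : nmY (nmvL s i) = nmbs s * nmYL i := by
  cases s <;> fin_cases i <;> simp [nmvL, nmY, nmSg, nmH, nmLab, nmbs, nmYL]

theorem nm_vK_lab : ∀ (s : Bool) (j : Fin 22), j ≠ 8 → j ≠ 18 →
    nmLab (nmH (nmvK s j)) = .inr j ∧ nmSg (nmvK s j) = nmbs s := by
  decide +kernel

theorem nm_vK_X (s : Bool) (j : Fin 22) : nmX (nmvK s j) = nmXK j := by
  by_cases h8 : j = 8
  · subst h8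
    have : nmXK 8 = nmTx := by simp [nmXK, nmKt]
    rw [this]
    cases s <;> rfl
  by_cases h18 : j = 18
  · subst h18
    cases s <;> rfl
  rw [nmX, (nm_vK_lab s j h8 h18).1]
  rfl

theorem nm_YK18 : nmYK 18 = 0 := by
  simp [nmYK, nmKt]
  ring

theorem nm_vK_Y (s : Bool) (j : Fin 22) : nmY (nmvK s j) = nmbs s * nmYK j := by
  by_cases h8 : j = 8
  · subst h8
    have : nmYK 8 = nmTy := by simp [nmYK, nmKt]
    rw [this]
    cases s <;> simp [nmvK, nmY, nmSg, nmH, nmLab, nmbs, nmYL]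
  by_cases h18 : j = 18
  · subst h18
    rw [nm_YK18, mul_zero]
    have : nmLab (nmH (nmvK s 18)) = .inr 18 := by cases s <;> rfl
    rw [nmY, this]
    simp [nm_YK18]
  rw [nmY, (nm_vK_lab s j h8 h18).1, (nm_vK_lab s j h8 h18).2]
  rfl

def nmSrt (a b : Fin 60) : Fin 60 × Fin 60 := if a < b then (a, b) else (b, a)

def nmGen (s : Bool) : List (Fin 60 × Fin 60) :=
  nmLE.map (fun e => nmSrt (nmvL s e.1) (nmvL s e.2)) ++
  nmKE.map (fun e => nmSrt (nmvK s e.1) (nmvK s e.2))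

def nmEL : List (Fin 60 × Fin 60) := nmEC.map (fun r => (r.u, r.v))

theorem nm_EL_eq : nmEL = nmGen true ++ nmGen false := by decide +kernel

theorem nm_EL_nodup : nmEL.Nodup := by decide +kernel

noncomputable def nmE : Finset (Fin 60 × Fin 60) := ⟨nmEL, nm_EL_nodup⟩

theorem nm_mem_E (e) : e ∈ nmE ↔ e ∈ nmEL := Iff.rfl

noncomputable def nmt : ℝ := √((nmXL 0 - nmXL 1) ^ 2 + (nmYL 0 - nmYL 1) ^ 2)

theorem nmt_bd : 1.09 ≤ nmt ∧ nmt ≤ 1.098 := by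
  have h1 := nmw_bd
  have h2 := nmx_bd
  have h4 := nmb_bd
  have h5 := nmg0_bd
  have e : nmt = √((nmx - nmw - nmg0) ^ 2 + nmb ^ 2) := by
    unfold nmt
    congr 1
    simp [nmXL, nmYL]
    ring
  have q1 : (0.6718 : ℝ) ≤ nmx - nmw - nmg0 := by linarith
  have q2 : nmx - nmw - nmg0 ≤ (0.6719 : ℝ) := by linarith
  rw [e]
  apply nm_sqrt_bd _ _ _ (by norm_num) <;> nlinarith

theorem nm_srt_dist (a b : Fin 60) :
    dist (nmP (nmSrt a b).1) (nmP (nmSrt a b).2) = dist (nmP a) (nmP b) := by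
  unfold nmSrt
  split_ifs
  · rfl
  · exact dist_comm _ _

theorem nm_bs_sq (s : Bool) : (nmbs s : ℝ) ^ 2 = 1 := by cases s <;> simp [nmbs]

theorem nm_dist_L (s : Bool) (i j : Fin 11) : dist (nmP (nmvL s i)) (nmP (nmvL s j))
    = √((nmXL i - nmXL j) ^ 2 + (nmYL i - nmYL j) ^ 2) := by
  rw [nm_dist, nm_vL_X, nm_vL_X, nm_vL_Y, nm_vL_Y]
  congr 1
  linear_combination (nmYL i - nmYL j) ^ 2 * nm_bs_sq s

theorem nm_dist_K (s : Bool) (i j : Fin 22) : dist (nmP (nmvK s i)) (nmP (nmvK s j))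
    = √((nmXK i - nmXK j) ^ 2 + (nmYK i - nmYK j) ^ 2) := by
  rw [nm_dist, nm_vK_X, nm_vK_X, nm_vK_Y, nm_vK_Y]
  congr 1
  linear_combination (nmYK i - nmYK j) ^ 2 * nm_bs_sq s

theorem nm_ex : ∀ s, nmSrt (nmvL s 0) (nmvL s 1) = (0, 4) ∨ nmSrt (nmvL s 0) (nmvL s 1) = (0, 32) := by
  decide +kernel

theorem nm_class (e) (he : e ∈ nmEL) :
    (dist (nmP e.1) (nmP e.2) = 1) ∨ ((e = (0, 4) ∨ e = (0, 32)) ∧ dist (nmP e.1) (nmP e.2) = nmt) := by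
  rw [nm_EL_eq] at he
  obtain ⟨s, hs⟩ : ∃ s, e ∈ nmGen s := by
    rcases List.mem_append.1 he with h | h
    exacts [⟨_, h⟩, ⟨_, h⟩]
  rcases List.mem_append.1 hs with h | h
  · obtain ⟨f, hf, rfl⟩ := List.mem_map.1 h
    rw [nm_srt_dist, nm_dist_L]
    by_cases hf0 : f = (0, 1)
    · subst hf0
      exact Or.inr ⟨nm_ex s, rfl⟩
    · left
      rw [nm_unit_L f hf hf0, Real.sqrt_one]
  · obtain ⟨f, hf, rfl⟩ := List.mem_map.1 h
    rw [nm_srt_dist, nm_dist_K, nm_unit_K f hf, Real.sqrt_one]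
    exact Or.inl rfl

theorem nm_dist_ex (e : Fin 60 × Fin 60) (h : e = (0, 4) ∨ e = (0, 32)) :
    dist (nmP e.1) (nmP e.2) = nmt := by
  rcases h with rfl | rfl
  · exact nm_dist_L true 0 1
  · exact nm_dist_L false 0 1

/-! Non-crossing certificates. -/

def nmLt (n m px py qx qy : ℤ) : Bool :=
  decide (n * px + m * py + 6000 * ((n.natAbs : ℤ) + m.natAbs) < n * qx + m * qy)

def nmSep (e f : NmRec) (n m : ℤ) : Bool :=
  nmLt n m e.ax e.ay f.ax f.ay && (nmLt n m e.ax e.ay f.bx f.bz &&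
  (nmLt n m e.bx e.bz f.ax f.ay && nmLt n m e.bx e.bz f.bx f.bz))

def nmSh1 (sx sy px py qx qy n m : ℤ) : Bool :=
  nmLt n m qx qy sx sy && nmLt n m sx sy px py

def nmSh (sx sy px py qx qy : ℤ) : Bool :=
  nmSh1 sx sy px py qx qy (px - qx) (py - qy) ||
  (nmSh1 sx sy px py qx qy (py + qy - 2 * sy) (2 * sx - px - qx) ||
   nmSh1 sx sy px py qx qy (2 * sy - py - qy) (px + qx - 2 * sx))

def nmDis (e f : NmRec) : Bool :=
  nmSep e f (-1) 0 || (nmSep e f 1 0 || (nmSep e f 0 1 || (nmSep e f 0 (-1) ||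
  (nmSep e f (e.ay - e.bz) (e.bx - e.ax) || (nmSep e f (e.bz - e.ay) (e.ax - e.bx) ||
  (nmSep e f (f.ay - f.bz) (f.bx - f.ax) || nmSep e f (f.bz - f.ay) (f.ax - f.bx)))))))

def nmChk (e f : NmRec) : Bool :=
  if e.u = f.u then nmSh e.ax e.ay e.bx e.bz f.bx f.bz
  else if e.u = f.v then nmSh e.ax e.ay e.bx e.bz f.ax f.ay
  else if e.v = f.u then nmSh e.bx e.bz e.ax e.ay f.bx f.bz
  else if e.v = f.v then nmSh e.bx e.bz e.ax e.ay f.ax f.ay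
  else nmDis e f

def nmAll : List NmRec → Bool
  | [] => true
  | e :: l => l.all (nmChk e) && nmAll l

theorem nm_all_run : nmAll nmEC = true := by decide +kernel

def nmGood (e : NmRec) : Prop :=
  e.ax = nmAX e.u ∧ e.ay = nmAY e.u ∧ e.bx = nmAX e.v ∧ e.bz = nmAY e.v

theorem nm_good_run : ∀ e ∈ nmEC, nmGood e := by
  have : ∀ e ∈ nmEC, e.ax = nmAX e.u ∧ e.ay = nmAY e.u ∧ e.bx = nmAX e.v ∧ e.bz = nmAY e.v := by
    decide +kernel
  exact this

theorem nm_lt_sound (n m : ℤ) (p q : Fin 60)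
    (h : nmLt n m (nmAX p) (nmAY p) (nmAX q) (nmAY q) = true) :
    n * nmX p + m * nmY p < n * nmX q + m * nmY q := by
  have h1 : n * nmAX p + m * nmAY p + 6000 * ((n.natAbs : ℤ) + m.natAbs)
      < n * nmAX q + m * nmAY q := of_decide_eq_true h
  rw [Int.natCast_natAbs, Int.natCast_natAbs] at h1
  have h2 : (n : ℝ) * nmAX p + m * nmAY p + 6000 * (|(n : ℝ)| + |(m : ℝ)|)
      < n * nmAX q + m * nmAY q := by exact_mod_cast h1
  have key : ∀ (k a b : ℝ), |a - b| ≤ 3000 → k * a - k * b ≤ 3000 * |k| ∧ k * b - k * a ≤ 3000 * |k| := by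
    intro k a b hab
    have : |k * (a - b)| ≤ |k| * 3000 := by
      rw [abs_mul]
      exact mul_le_mul_of_nonneg_left hab (abs_nonneg k)
    rw [abs_le] at this
    constructor <;> linarith [this.1, this.2]
  have a1 := key n _ _ (nm_apX p)
  have a2 := key m _ _ (nm_apY p)
  have a3 := key n _ _ (nm_apX q)
  have a4 := key m _ _ (nm_apY q)
  linarith [a1.1, a1.2, a2.1, a2.2, a3.1, a3.2, a4.1, a4.2]

def nmNC (a b c d : Fin 60) : Prop :=
  ∀ x ∈ segment ℝ (nmP a) (nmP b) ∩ segment ℝ (nmP c) (nmP d),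
    (x = nmP a ∨ x = nmP b) ∧ (x = nmP c ∨ x = nmP d)

theorem nm_sep_sound (n m : ℝ) (a b c d : Fin 60)
    (h1 : n * nmX a + m * nmY a < n * nmX c + m * nmY c)
    (h2 : n * nmX a + m * nmY a < n * nmX d + m * nmY d)
    (h3 : n * nmX b + m * nmY b < n * nmX c + m * nmY c)
    (h4 : n * nmX b + m * nmY b < n * nmX d + m * nmY d) : nmNC a b c d := by
  rintro x ⟨⟨α, β, hα, hβ, hs, rfl⟩, ⟨γ, δ, hγ, hδ, hs', hx⟩⟩
  exfalso
  have e0 := congrFun (congrArg WithLp.ofLp hx) 0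
  have e1 := congrFun (congrArg WithLp.ofLp hx) 1
  simp [nmP] at e0 e1
  obtain rfl : β = 1 - α := by linarith
  obtain rfl : δ = 1 - γ := by linarith
  generalize hA : n * nmX a + m * nmY a = A at *
  generalize hB : n * nmX b + m * nmY b = B at *
  generalize hC : n * nmX c + m * nmY c = C at *
  generalize hD : n * nmX d + m * nmY d = D at *
  have e : γ * C + (1 - γ) * D = α * A + (1 - α) * B := by
    rw [← hA, ← hB, ← hC, ← hD]
    linear_combination n * e0 + m * e1
  have k1 : α * A + (1 - α) * B ≤ max A B := by
    nlinarith [le_max_left A B, le_max_right A B]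
  have k2 : min C D ≤ γ * C + (1 - γ) * D := by
    nlinarith [min_le_left C D, min_le_right C D]
  have k3 : max A B < min C D := by
    rw [max_lt_iff, lt_min_iff, lt_min_iff]
    exact ⟨⟨h1, h2⟩, h3, h4⟩
  linarith

theorem nm_sh_aux (n m : ℝ) (s p q : Fin 60)
    (h1 : n * nmX q + m * nmY q < n * nmX s + m * nmY s)
    (h2 : n * nmX s + m * nmY s < n * nmX p + m * nmY p) (x)
    (hx1 : x ∈ segment ℝ (nmP s) (nmP p)) (hx2 : x ∈ segment ℝ (nmP s) (nmP q)) : x = nmP s := by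
  obtain ⟨α, β, hα, hβ, hs, rfl⟩ := hx1
  obtain ⟨γ, δ, hγ, hδ, hs', hx⟩ := hx2
  have e0 := congrFun (congrArg WithLp.ofLp hx) 0
  have e1 := congrFun (congrArg WithLp.ofLp hx) 1
  simp [nmP] at e0 e1
  obtain rfl : α = 1 - β := by linarith
  obtain rfl : γ = 1 - δ := by linarith
  have e : δ * (n * nmX s + m * nmY s - (n * nmX q + m * nmY q))
      + β * (n * nmX p + m * nmY p - (n * nmX s + m * nmY s)) = 0 := by
    linear_combination -n * e0 - m * e1
  have hb : β = 0 := by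
    by_contra hne
    have : 0 < β := lt_of_le_of_ne hβ (Ne.symm hne)
    nlinarith [mul_pos this (sub_pos.2 h2), mul_nonneg hδ (sub_pos.2 h1).le]
  subst hb
  simp

theorem nm_sh_sound (s p q : Fin 60)
    (h : nmSh (nmAX s) (nmAY s) (nmAX p) (nmAY p) (nmAX q) (nmAY q) = true) (x)
    (hx1 : x ∈ segment ℝ (nmP s) (nmP p)) (hx2 : x ∈ segment ℝ (nmP s) (nmP q)) : x = nmP s := by
  have go : ∀ n m : ℤ, nmSh1 (nmAX s) (nmAY s) (nmAX p) (nmAY p) (nmAX q) (nmAY q) n m = true →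
      x = nmP s := by
    intro n m hh
    obtain ⟨a, b⟩ := (Bool.and_eq_true _ _).mp hh
    exact nm_sh_aux n m s p q (nm_lt_sound _ _ _ _ a) (nm_lt_sound _ _ _ _ b) x hx1 hx2
  unfold nmSh at h
  rw [Bool.or_eq_true, Bool.or_eq_true] at h
  rcases h with h | h | h <;> exact go _ _ h

theorem nm_dis_sound (e f : NmRec) (he : nmGood e) (hf : nmGood f) (h : nmDis e f = true) :
    nmNC e.u e.v f.u f.v := by
  have go : ∀ n m : ℤ, nmSep e f n m = true → nmNC e.u e.v f.u f.v := by
    intro n m hh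
    unfold nmSep at hh
    rw [he.1, he.2.1, he.2.2.1, he.2.2.2, hf.1, hf.2.1, hf.2.2.1, hf.2.2.2] at hh
    simp only [Bool.and_eq_true] at hh
    exact nm_sep_sound n m _ _ _ _ (nm_lt_sound _ _ _ _ hh.1) (nm_lt_sound _ _ _ _ hh.2.1)
      (nm_lt_sound _ _ _ _ hh.2.2.1) (nm_lt_sound _ _ _ _ hh.2.2.2)
  unfold nmDis at h
  simp only [Bool.or_eq_true] at h
  rcases h with h | h | h | h | h | h | h | h <;> exact go _ _ h

theorem nm_chk_sound (e f : NmRec) (he : nmGood e) (hf : nmGood f) (h : nmChk e f = true) :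
    nmNC e.u e.v f.u f.v := by
  unfold nmChk at h
  split_ifs at h with c1 c2 c3 c4
  · rw [he.1, he.2.1, he.2.2.1, he.2.2.2, hf.2.2.1, hf.2.2.2] at h
    rintro x ⟨h1, h2⟩
    rw [← c1] at h2 ⊢
    have := nm_sh_sound _ _ _ h x h1 h2
    exact ⟨Or.inl this, Or.inl this⟩
  · rw [he.1, he.2.1, he.2.2.1, he.2.2.2, hf.1, hf.2.1] at h
    rintro x ⟨h1, h2⟩
    rw [← c2] at h2 ⊢
    rw [segment_symm] at h2
    have := nm_sh_sound _ _ _ h x h1 h2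
    exact ⟨Or.inl this, Or.inr this⟩
  · rw [he.1, he.2.1, he.2.2.1, he.2.2.2, hf.2.2.1, hf.2.2.2] at h
    rintro x ⟨h1, h2⟩
    rw [← c3] at h2 ⊢
    rw [segment_symm] at h1
    have := nm_sh_sound _ _ _ h x h1 h2
    exact ⟨Or.inr this, Or.inl this⟩
  · rw [he.1, he.2.1, he.2.2.1, he.2.2.2, hf.1, hf.2.1] at h
    rintro x ⟨h1, h2⟩
    rw [← c4] at h2 ⊢
    rw [segment_symm] at h1 h2
    have := nm_sh_sound _ _ _ h x h1 h2
    exact ⟨Or.inr this, Or.inr this⟩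
  · exact nm_dis_sound e f he hf h

theorem nm_all_pairwise (l : List NmRec) (hg : ∀ e ∈ l, nmGood e) (h : nmAll l = true) :
    (l.map (fun r => (r.u, r.v))).Pairwise (fun e f => nmNC e.1 e.2 f.1 f.2) := by
  induction l with
  | nil => simp
  | cons e l ih =>
    unfold nmAll at h
    rw [Bool.and_eq_true, List.all_eq_true] at h
    rw [List.map_cons, List.pairwise_cons]
    refine ⟨?_, ih (fun f hf => hg f (List.mem_cons_of_mem _ hf)) h.2⟩
    intro f' hf'
    obtain ⟨f, hf, rfl⟩ := List.mem_map.1 hf'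
    exact nm_chk_sound e f (hg e List.mem_cons_self) (hg f (List.mem_cons_of_mem _ hf)) (h.1 f hf)

theorem nm_noncross (e f) (he : e ∈ nmEL) (hf : f ∈ nmEL) (hef : e ≠ f) :
    nmNC e.1 e.2 f.1 f.2 := by
  have hp := nm_all_pairwise nmEC nm_good_run nm_all_run
  haveI : Std.Symm (fun e f : Fin 60 × Fin 60 => nmNC e.1 e.2 f.1 f.2) :=
    ⟨fun e f h x hx => (h x ⟨hx.2, hx.1⟩).symm⟩
  exact hp.forall he hf hef

theorem nm_inj_run : ∀ u v : Fin 60, u ≠ v →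
    6000 < (nmAX u - nmAX v).natAbs ∨ 6000 < (nmAY u - nmAY v).natAbs := by decide +kernel

theorem nm_inj : Function.Injective nmP := by
  intro u v h
  by_contra hne
  have e0 : nmX u = nmX v := by simpa [nmP] using congrFun (congrArg WithLp.ofLp h) 0
  have e1 : nmY u = nmY v := by simpa [nmP] using congrFun (congrArg WithLp.ofLp h) 1
  have key : ∀ (a : ℝ) (p q : ℤ), |a - p| ≤ 3000 → |a - q| ≤ 3000 → (p - q).natAbs ≤ 6000 := by
    intro a p q h1 h2
    have h3 : |(p : ℝ) - q| ≤ 6000 := by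
      rw [abs_le] at *
      constructor <;> linarith [h1.1, h1.2, h2.1, h2.2]
    have h4 : |p - q| ≤ 6000 := by exact_mod_cast h3
    rw [Int.abs_eq_natAbs] at h4
    exact_mod_cast h4
  have k0 := key _ _ _ (nm_apX u) (by rw [e0]; exact nm_apX v)
  have k1 := key _ _ _ (nm_apY u) (by rw [e1]; exact nm_apY v)
  rcases nm_inj_run u v hne with h | h <;> omega

theorem nm_ord : ∀ e ∈ nmEL, e.1 < e.2 := by decide +kernel

theorem nm_deg : ∀ v : Fin 60, (nmEL.filter (fun e => decide (e.1 = v ∨ e.2 = v))).length = 4 := by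
  decide +kernel

theorem nm_118 : (nmEL.filter (fun e => decide (¬(e = (0, 4) ∨ e = (0, 32))))).length = 118 := by
  decide +kernel

theorem nm_card_filter (p : Fin 60 × Fin 60 → Prop) [i1 : DecidablePred p] (q : Fin 60 × Fin 60 → Prop)
    [DecidablePred q] (n : ℕ) (h : ∀ e ∈ nmEL, p e ↔ q e)
    (hn : (nmEL.filter (fun e => decide (q e))).length = n) : (nmE.filter p).card = n := by
  rw [Finset.filter_congr (q := q) (fun e he => h e he), ← hn]
  rfl

open scoped Classical

theorem near_matchstick_60 :
    ∃ (P : Fin 60 → EuclideanSpace ℝ (Fin 2)) (E : Finset (Fin 60 × Fin 60)),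
      Function.Injective P ∧
      (∀ e ∈ E, e.1 < e.2) ∧
      E.card = 120 ∧
      (∀ v : Fin 60, (E.filter (fun e => e.1 = v ∨ e.2 = v)).card = 4) ∧
      (∀ e ∈ E, ∀ f ∈ E, e ≠ f →
        ∀ x ∈ segment ℝ (P e.1) (P e.2) ∩ segment ℝ (P f.1) (P f.2),
          (x = P e.1 ∨ x = P e.2) ∧ (x = P f.1 ∨ x = P f.2)) ∧
      (E.filter (fun e => dist (P e.1) (P e.2) = 1)).card = 118 ∧
      (∃ t : ℝ, |t - 1| < 0.099 ∧
        ∀ e ∈ E, dist (P e.1) (P e.2) = 1 ∨ dist (P e.1) (P e.2) = t) := by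
  refine ⟨nmP, nmE, nm_inj, fun e he => nm_ord e he, by rfl, fun v => ?_, ?_, ?_, nmt, ?_, ?_⟩
  · exact nm_card_filter _ _ 4 (fun e _ => Iff.rfl) (nm_deg v)
  · intro e he f hf hef
    exact nm_noncross e f he hf hef
  · refine nm_card_filter _ (fun e => ¬(e = (0, 4) ∨ e = (0, 32))) 118 (fun e he => ?_) nm_118
    constructor
    · intro h1 h2
      rw [nm_dist_ex e h2] at h1
      have := nmt_bd
      linarith [this.1]
    · intro h1
      rcases nm_class e he with h | h
      · exact h
      · exact absurd h.1 h1
  · have := nmt_bd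
    rw [abs_lt]
    constructor <;> linarith [this.1, this.2]
  · intro e he
    rcases nm_class e he with h | h
    · exact Or.inl h
    · exact Or.inr h.2
end
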